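/- The set Ω* is F-measurable, it is translation invariant (ω ∈ Ω* if and only if τ_x(ω) ∈ Ω* for all x ∈ Z^d), and ν(Ω*) = 1 for every translation-invariant, ergodic probability measure ν on (Ω,F). -/

import Mathlib

open MeasureTheory Filter Topology Matrix
open scoped ENNReal NNReal

noncomputable section

namespace DetCond

/-- Vertices of `ℤ^d`. -/
abbrev Vert (d : ℕ) := Fin d → ℤ

/-- Index of the (unordered) nearest-neighbour edge `(x, x + e i)` of `ℤ^d`;
the set of these indices is in natural bijection with `E(ℤ^d)` modulo orientation. -/
abbrev EdgeIx (d : ℕ) := Vert d × Fin d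

/-- The space `Ω = (0,∞)^{E(ℤ^d)}` of (symmetric) conductance configurations, with
its product topology and product σ-algebra. -/
abbrev EnvSp (d : ℕ) := {ω : EdgeIx d → ℝ // ∀ e, 0 < ω e}

/-- The `i`-th coordinate unit vector of `ℤ^d`. -/
def unitv (d : ℕ) (i : Fin d) : Vert d := fun j => if j = i then 1 else 0

/-- The translation `τ_x` acting on environments: `c_{τ_x ω}(y,z) = c_ω(y+x,z+x)`. -/
def shift (d : ℕ) (x : Vert d) (ω : EnvSp d) : EnvSp d :=
  ⟨fun e => ω.1 (e.1 + x, e.2), fun e => ω.2 (e.1 + x, e.2)⟩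

/-- The conductance `c_ω(x,y)`; it vanishes when `x,y` are not nearest neighbours
and is symmetric in `x,y` by construction. -/
def cnd (d : ℕ) (ω : EnvSp d) (x y : Vert d) : ℝ :=
  ∑ i, ((if y = x + unitv d i then ω.1 (x, i) else 0) +
        (if x = y + unitv d i then ω.1 (y, i) else 0))

/-- `π_ω(x) = Σ_{z : (x,z) ∈ E(ℤ^d)} c_ω(x,z)`. -/
def piOf (d : ℕ) (ω : EnvSp d) (x : Vert d) : ℝ :=
  ∑ i, (ω.1 (x, i) + ω.1 (x - unitv d i, i))

/-- The box `Λ_r = [-r,r]^d ∩ ℤ^d`. -/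
def box (d : ℕ) (r : ℝ) : Finset (Vert d) :=
  Fintype.piFinset fun _ : Fin d => Finset.Icc ⌈-r⌉ ⌊r⌋

/-- The nearest neighbours of `x` in `ℤ^d`. -/
def nbrs (d : ℕ) (x : Vert d) : Finset (Vert d) :=
  (Finset.univ.image fun i => x + unitv d i) ∪ (Finset.univ.image fun i => x - unitv d i)

/-- The set `E(Λ)` of edges incident with at least one vertex of `Λ`
(one index per unordered edge). -/
def edgesIn (d : ℕ) (Λ : Finset (Vert d)) : Finset (EdgeIx d) :=
  Λ.biUnion fun x =>
    (Finset.univ.image fun i => (x, i)) ∪ (Finset.univ.image fun i => (x - unitv d i, i))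

/-- Bounded functions on `Ω`. -/
def IsBdd (d : ℕ) (f : EnvSp d → ℝ) : Prop := ∃ M, ∀ ω, |f ω| ≤ M

/-- Local functions: `f` depends only on the coordinates in some finite set `B` of edges
and, viewed as a function of those coordinates, has compact support in `(0,∞)^B`. -/
def IsLocalFn (d : ℕ) (f : EnvSp d → ℝ) : Prop :=
  ∃ B : Finset (EdgeIx d),
    (∀ ω₁ ω₂ : EnvSp d, (∀ e ∈ B, ω₁.1 e = ω₂.1 e) → f ω₁ = f ω₂) ∧
    ∃ a b : ℝ, 0 < a ∧ ∀ ω : EnvSp d, (∃ e ∈ B, ω.1 e < a ∨ b < ω.1 e) → f ω = 0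

/-- `ℓ_ω(f) = L`, i.e. the block averages of the translates of `f` converge to `L`. -/
def avgTo (d : ℕ) (ω : EnvSp d) (f : EnvSp d → ℝ) (L : ℝ) : Prop :=
  Tendsto (fun n : ℕ => (∑ x ∈ box d (n : ℝ), f (shift d x ω)) / ((box d (n : ℝ)).card : ℝ))
    atTop (𝓝 L)

/-- `ω` is averaging: `ℓ_ω(f)` exists for every continuous local `f`. -/
def Averaging (d : ℕ) (ω : EnvSp d) : Prop :=
  ∀ f : EnvSp d → ℝ, Continuous f → IsLocalFn d f → ∃ L, avgTo d ω f L

/-- `ω` is tempered, i.e. `ω ∈ Ω'`. -/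
def Tempered (d : ℕ) (ω : EnvSp d) : Prop :=
  Tendsto (fun ε : ℝ =>
      limsup (fun n : ℕ =>
        (∑ e ∈ edgesIn d (box d (n : ℝ)),
            (if ε ≤ ω.1 e ∧ ω.1 e ≤ ε⁻¹ then (0:ℝ) else 1)) / (n : ℝ) ^ d) atTop)
    (𝓝[>] 0) (𝓝 0)

/-- `P` is the measure `ℙ_ω` associated with an averaging tempered `ω`:
the unique probability measure whose expectation of every bounded continuous function
is the corresponding block-average limit `ℓ_ω(f)`. -/
def IsEnvLaw (d : ℕ) (ω : EnvSp d) (P : Measure (EnvSp d)) : Prop :=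
  IsProbabilityMeasure P ∧
    ∀ f : EnvSp d → ℝ, Continuous f → IsBdd d f → avgTo d ω f (∫ ω', f ω' ∂P)

/-- Ergodicity of a measure on `Ω` with respect to the translations of `ℤ^d`. -/
def ErgodicEnv (d : ℕ) (P : Measure (EnvSp d)) : Prop :=
  ∀ A : Set (EnvSp d), MeasurableSet A → (∀ x : Vert d, shift d x ⁻¹' A = A) →
    P A = 0 ∨ P A = 1

/-- `ω ∈ Ω⋆`: tempered, averaging, and the associated measure `ℙ_ω` is ergodic. -/
def InOmegaStar (d : ℕ) (ω : EnvSp d) : Prop :=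
  Tempered d ω ∧ Averaging d ω ∧
    ∀ P : Measure (EnvSp d), IsEnvLaw d ω P → ErgodicEnv d P

/-- `ω ∈ Ω_{p,q}`. -/
def InOmegaPQ (d : ℕ) (p q : ℝ) (ω : EnvSp d) : Prop :=
  (∃ C : ℝ, ∀ n : ℕ, 1 ≤ n →
      (∑ e ∈ edgesIn d (box d (n : ℝ)), ω.1 e ^ p) / (n : ℝ) ^ d ≤ C) ∧
  (∃ C : ℝ, ∀ n : ℕ, 1 ≤ n →
      (∑ e ∈ edgesIn d (box d (n : ℝ)), ω.1 e ^ (-q)) / (n : ℝ) ^ d ≤ C)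

/-- The path space of the discrete-time walk. -/
abbrev Path (d : ℕ) := ℕ → Vert d

/-- One-step transition probabilities `𝖯_ω(x,y) = c_ω(x,y)/π_ω(x)`. -/
def transP (d : ℕ) (ω : EnvSp d) (x y : Vert d) : ℝ := cnd d ω x y / piOf d ω x

/-- `μ` is the law `P_ω^{x₀}` of the random walk among the conductances `ω`
started at `x₀`: a probability measure on the path space with the prescribed
finite-dimensional (cylinder) probabilities. -/
def IsWalkLaw (d : ℕ) (ω : EnvSp d) (x₀ : Vert d) (μ : Measure (Path d)) : Prop :=
  IsProbabilityMeasure μ ∧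
    ∀ (n : ℕ) (γ : ℕ → Vert d),
      μ {w | ∀ k ≤ n, w k = γ k} =
        (if γ 0 = x₀ then 1 else 0) *
          ∏ k ∈ Finset.range n, ENNReal.ofReal (transP d ω (γ k) (γ (k+1)))

/-- `n`-step transition probabilities of the discrete-time walk. -/
def stepP (d : ℕ) (ω : EnvSp d) : ℕ → Vert d → Vert d → ℝ
  | 0, x, y => if x = y then 1 else 0
  | n+1, x, y => ∑ z ∈ nbrs d x, transP d ω x z * stepP d ω n z y

/-- `P_ω^x(Y_t = y)` for the constant-speed continuous-time walk `Y_t = X_{N(t)}`,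
where `N` is an independent rate-1 Poisson process. -/
def ctP (d : ℕ) (ω : EnvSp d) (t : ℝ) (x y : Vert d) : ℝ :=
  ∑' k : ℕ, Real.exp (-t) * t ^ k / (Nat.factorial k : ℝ) * stepP d ω k x y

/-- The `ℓ¹`-norm of a vertex of `ℤ^d`. -/
def l1 (d : ℕ) (x : Vert d) : ℝ := ∑ i, |(x i : ℝ)|

/-- A vertex of `ℤ^d` regarded as a point of `ℝ^d`. -/
def ivert (d : ℕ) (x : Vert d) : Fin d → ℝ := fun i => (x i : ℝ)

/-- The linearly interpolated diffusively rescaled walk `B^{(n)}`. -/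
def BnProc (d : ℕ) (n : ℕ) (w : Path d) (t : ℝ) : Fin d → ℝ :=
  (Real.sqrt n)⁻¹ •
    (ivert d (w ⌊t * n⌋₊) +
      (t * n - (⌊t * n⌋₊ : ℝ)) • (ivert d (w (⌊t * n⌋₊ + 1)) - ivert d (w ⌊t * n⌋₊)))


/-- The measure `ℚ_ω` obtained from `ℙ_ω` by tilting with `π(0)`. -/
def Qmeas (d : ℕ) (P : Measure (EnvSp d)) : Measure (EnvSp d) :=
  P.withDensity fun ω' => ENNReal.ofReal (piOf d ω' 0 / ∫ ω'', piOf d ω'' 0 ∂P)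

/-- The inner product `⟨f,g⟩_{L²(πμ)}`. -/
def innerP (d : ℕ) (P : Measure (EnvSp d)) (f g : EnvSp d → ℝ) : ℝ :=
  ∫ ω', f ω' * g ω' * piOf d ω' 0 ∂P

/-- The Dirichlet pairing `⟨h, (−L)h⟩_{L²(πμ)}`. -/
def quadL (d : ℕ) (P : Measure (EnvSp d)) (h : EnvSp d → ℝ) : ℝ :=
  ∫ ω', (∑ z ∈ nbrs d 0, cnd d ω' 0 z * (h ω' - h (shift d z ω'))) * h ω' ∂P

/-- The inner product of `L²(ν)`. -/
def innerQ (d : ℕ) (ν : Measure (EnvSp d)) (f g : EnvSp d → ℝ) : ℝ :=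
  ∫ ω', f ω' * g ω' ∂ν

/-- The Dirichlet pairing `⟨h, (−L)h⟩_{L²(ν)}`. -/
def quadQ (d : ℕ) (ν : Measure (EnvSp d)) (h : EnvSp d → ℝ) : ℝ :=
  ∫ ω', ((piOf d ω' 0)⁻¹ *
      ∑ z ∈ nbrs d 0, cnd d ω' 0 z * (h ω' - h (shift d z ω'))) * h ω' ∂ν

/-- The set whose supremum is the variational characterization
`⟨f,(−L)⁻¹f⟩_{L²(ν)} = sup_h [2⟨h,f⟩ − ⟨h,(−L)h⟩]` (over bounded continuous `h`);
`⟨f,(−L)⁻¹f⟩_{L²(ν)} < ∞` means this set is bounded above. -/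
def invPairSet (d : ℕ) (ν : Measure (EnvSp d)) (f : EnvSp d → ℝ) : Set ℝ :=
  {r | ∃ h : EnvSp d → ℝ, Continuous h ∧ IsBdd d h ∧
        r = 2 * innerQ d ν h f - quadQ d ν h}

/-- The function `f(ω) = π_ω(0)⁻¹ ∇⋆(c v)(ω)` built from a vector field `v`. -/
def fDiv (d : ℕ) (v : EnvSp d → Fin d → ℝ) (ω : EnvSp d) : ℝ :=
  (piOf d ω 0)⁻¹ *
    ∑ i, (cnd d ω 0 (unitv d i) * v ω i -
          cnd d ω (-(unitv d i)) 0 * v (shift d (-(unitv d i)) ω) i)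

/-- The inner product of `ℓ²(Λ,π_ω)`. -/
def innerF (d : ℕ) (ω : EnvSp d) (Λ : Finset (Vert d)) (f g : Vert d → ℝ) : ℝ :=
  ∑ x ∈ Λ, f x * g x * piOf d ω x

/-- The pairing `⟨h, (−𝖫_ω)h⟩_{ℓ²(Λ,π_ω)}` for `h` vanishing outside `Λ`. -/
def quadF (d : ℕ) (ω : EnvSp d) (Λ : Finset (Vert d)) (h : Vert d → ℝ) : ℝ :=
  ∑ x ∈ Λ, (∑ z ∈ nbrs d x, cnd d ω x z * (h x - h z)) * h x

/-- `⟨f, (−𝖫_ω)⁻¹_Λ f⟩_{ℓ²(Λ,π_ω)}` via its variational characterization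
`sup_h [2⟨h,f⟩ − ⟨h,(−𝖫_ω)h⟩]` over `h ∈ ℓ²(Λ,π_ω)`. -/
def invPairF (d : ℕ) (ω : EnvSp d) (Λ : Finset (Vert d)) (f : Vert d → ℝ) : ℝ :=
  sSup {r | ∃ h : Vert d → ℝ, (∀ x ∉ Λ, h x = 0) ∧
      r = 2 * innerF d ω Λ h f - quadF d ω Λ h}

/-- The antisymmetric edge function `v∘τ(ω)`: the value assigned to the
edge `(x, x+e_i)` is `v_i(τ_x(ω))`. -/
def efield (d : ℕ) (v : EnvSp d → Fin d → ℝ) (ω : EnvSp d) : Vert d → Fin d → ℝ :=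
  fun x i => v (shift d x ω) i

/-- The discrete gradient `∇h` of `h : ℤ^d → ℝ` as an edge function. -/
def dgradE (d : ℕ) (h : Vert d → ℝ) : Vert d → Fin d → ℝ :=
  fun x i => h (x + unitv d i) - h x

/-- The inner product `⟨u,w⟩_{ℓ²(E(Λ), c_ω)}` of (antisymmetric) edge functions;
each unordered edge is counted once, which agrees with the paper's sum over
ordered edges carrying the factor ½. -/
def einner (d : ℕ) (ω : EnvSp d) (Λ : Finset (Vert d)) (u w : Vert d → Fin d → ℝ) : ℝ :=
  ∑ e ∈ edgesIn d Λ, u e.1 e.2 * w e.1 e.2 * ω.1 e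

/-- The Dirichlet energy `𝓔_Λ^ω(v)`. -/
def direnergy (d : ℕ) (ω : EnvSp d) (Λ : Finset (Vert d)) (v : EnvSp d → Fin d → ℝ) : ℝ :=
  sInf {r | ∃ h : Vert d → ℝ, (∀ x ∉ Λ, h x = 0) ∧
      r = einner d ω Λ (fun x i => efield d v ω x i - dgradE d h x i)
            (fun x i => efield d v ω x i - dgradE d h x i)}

/-- The gradient `∇h` of a function on `Ω`. -/
def gradOmega (d : ℕ) (h : EnvSp d → ℝ) : EnvSp d → Fin d → ℝ :=
  fun ω i => h (shift d (unitv d i) ω) - h ω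

/-- The inner product `⟨u, c w⟩_{L²(P,ℝ^d)}`. -/
def cinnerP (d : ℕ) (P : Measure (EnvSp d)) (u w : EnvSp d → Fin d → ℝ) : ℝ :=
  ∑ i, ∫ ω', cnd d ω' 0 (unitv d i) * u ω' i * w ω' i ∂P

/-- Bounded vector fields on `Ω`. -/
def IsBddV (d : ℕ) (v : EnvSp d → Fin d → ℝ) : Prop := ∃ M, ∀ ω i, |v ω i| ≤ M

/-- The space `𝒱 = (ℝ^d)^{ℤ^d}` of vector fields on `ℤ^d`. -/
abbrev VS (d : ℕ) := Vert d → Fin d → ℝ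

/-- The empirical measures `μ_r^{ω,v}` built from the minimizers `h_r` of the
finite-volume Dirichlet energies. -/
def muR (d : ℕ) (ω : EnvSp d) (hr : ℕ → Vert d → ℝ) (r : ℕ) :
    Measure (EnvSp d × VS d) :=
  (((box d ((r : ℝ) + Real.sqrt r)).card : ℝ≥0∞) *
      ((box d (Real.sqrt r)).card : ℝ≥0∞))⁻¹ •
    ∑ z ∈ box d (Real.sqrt r), ∑ x ∈ box d ((r : ℝ) + Real.sqrt r),
      Measure.dirac (shift d (x + z) ω, fun y => dgradE d (hr r) (x + z + y))

/-- The localized conductances `c_ω^R`. -/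
def cR (d : ℕ) (ω : EnvSp d) (R : ℝ) (e : EdgeIx d) : ℝ :=
  if e ∈ edgesIn d (box d (2 * R)) then ω.1 e else 1

/-- The localized measure `π_ω^R`. -/
def piRloc (d : ℕ) (ω : EnvSp d) (R : ℝ) (x : Vert d) : ℝ :=
  if x ∈ box d (2 * R) then piOf d ω x
  else if x ∈ box d (4 * R) then 1 + piOf d ω x else 1

/-- The localized Dirichlet form `D_ω^R(f,f)` (each unordered edge counted once). -/
def DR (d : ℕ) (ω : EnvSp d) (R : ℝ) (f : Vert d → ℝ) : ℝ≥0∞ :=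
  ∑' e : EdgeIx d, ENNReal.ofReal (cR d ω R e * (f (e.1 + unitv d e.2) - f e.1) ^ 2)

/-- The norm `‖f‖_{ℓ^s(μ)}`. -/
def lpN (d : ℕ) (μw : Vert d → ℝ) (s : ℝ) (f : Vert d → ℝ) : ℝ≥0∞ :=
  (∑' x : Vert d, ENNReal.ofReal (|f x| ^ s * μw x)) ^ (1 / s)

/-- The exponent `ε = 2(2/d − 1/p − 1/q)((d−2)/d + 1/q)⁻¹`. -/
def epsPQ (d : ℕ) (p q : ℝ) : ℝ :=
  2 * (2 / (d : ℝ) - 1 / p - 1 / q) / (((d : ℝ) - 2) / (d : ℝ) + 1 / q)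

/-- Jump rates of the localized constant-speed chain `Y^R`:
rate `c_ω^R(x,y)/π_ω^R(x)` from `x` to `y`. -/
def rateR (d : ℕ) (ω : EnvSp d) (R : ℝ) (x y : Vert d) : ℝ :=
  (∑ i, ((if y = x + unitv d i then cR d ω R (x, i) else 0) +
         (if x = y + unitv d i then cR d ω R (y, i) else 0))) / piRloc d ω R x

/-- The generator matrix of `Y^R`. -/
def qmatR (d : ℕ) (ω : EnvSp d) (R : ℝ) (x y : Vert d) : ℝ :=
  if x = y then -(∑ z ∈ nbrs d x, rateR d ω R x z) else rateR d ω R x y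

/-- Iterates of the generator matrix of `Y^R`. -/
def qiter (d : ℕ) (ω : EnvSp d) (R : ℝ) : ℕ → Vert d → Vert d → ℝ
  | 0, x, y => if x = y then 1 else 0
  | n+1, x, y => ∑ z ∈ insert x (nbrs d x), qmatR d ω R x z * qiter d ω R n z y

/-- The heat kernel `P_ω^x(Y_t^R = y) = (e^{tQ})(x,y)` of the localized chain `Y^R`. -/
def hkR (d : ℕ) (ω : EnvSp d) (R : ℝ) (t : ℝ) (x y : Vert d) : ℝ :=
  ∑' k : ℕ, t ^ k / (Nat.factorial k : ℝ) * qiter d ω R k x y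

theorem mem_box_natCast {d : ℕ} {n : ℕ} {x : Vert d} :
    x ∈ box d (n : ℝ) ↔ ∀ i, |x i| ≤ (n : ℤ) := by
  simp only [box, Fintype.mem_piFinset, Finset.mem_Icc, Int.floor_natCast, abs_le]
  have : ⌈-(n : ℝ)⌉ = -(n : ℤ) := by simp [Int.ceil_neg]
  simp [this]

theorem card_box_natCast (d n : ℕ) : (box d (n : ℝ)).card = (2 * n + 1) ^ d := by
  have h : ⌈-(n : ℝ)⌉ = -(n : ℤ) := by simp [Int.ceil_neg]
  have h2 : ((n : ℤ) + 1 + (n : ℤ)).toNat = 2 * n + 1 := by omega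
  simp [box, h, h2]

theorem card_box_pos (d n : ℕ) : (0 : ℝ) < (box d (n : ℝ)).card := by
  rw [card_box_natCast]; positivity

theorem box_subset_box {d m n : ℕ} (h : m ≤ n) : box d (m : ℝ) ⊆ box d (n : ℝ) := by
  intro x hx
  rw [mem_box_natCast] at hx ⊢
  exact fun i => (hx i).trans (by exact_mod_cast h)

theorem add_mem_box {d m n : ℕ} {x y : Vert d} (hx : x ∈ box d (m : ℝ))
    (hy : y ∈ box d (n : ℝ)) : x + y ∈ box d ((m + n : ℕ) : ℝ) := by
  rw [mem_box_natCast] at *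
  intro i
  have := abs_add_le (x i) (y i)
  have h1 := hx i
  have h2 := hy i
  push_cast
  simp only [Pi.add_apply]
  linarith

theorem exists_mem_box {d : ℕ} (y : Vert d) : ∃ m : ℕ, y ∈ box d (m : ℝ) := by
  refine ⟨∑ i, (y i).natAbs, mem_box_natCast.2 fun i => ?_⟩
  have := Finset.single_le_sum (f := fun i => (y i).natAbs) (fun _ _ => Nat.zero_le _)
    (Finset.mem_univ i)
  rw [Int.abs_eq_natAbs]
  exact_mod_cast this

/-- Ratios of volumes of concentric boxes with a fixed difference of radii tend to one. -/
theorem tendsto_card_box_ratio (d m : ℕ) :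
    Tendsto (fun n : ℕ => ((box d ((n + m : ℕ) : ℝ)).card : ℝ) / (box d (n : ℝ)).card)
      atTop (𝓝 1) := by
  have h : Tendsto (fun n : ℕ => 1 + (2 * m : ℝ) / (2 * n + 1)) atTop (𝓝 (1 + 0)) := by
    refine tendsto_const_nhds.add (Tendsto.div_atTop tendsto_const_nhds ?_)
    exact tendsto_atTop_add_const_right _ _
      (tendsto_natCast_atTop_atTop.const_mul_atTop (by norm_num))
  have h2 := h.pow d
  simp only [add_zero, one_pow] at h2
  refine h2.congr fun n => ?_
  rw [card_box_natCast, card_box_natCast]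
  push_cast
  rw [← div_pow]
  congr 1
  field_simp
  ring

/-- Averages over boxes of a bounded function are asymptotically translation invariant. -/
theorem tendsto_box_avg_translate_sub (d : ℕ) (F : Vert d → ℝ) (M : ℝ) (hF : ∀ x, |F x| ≤ M)
    (y : Vert d) :
    Tendsto (fun n : ℕ => (∑ x ∈ box d (n : ℝ), F (x + y)) / ((box d (n : ℝ)).card : ℝ) -
      (∑ x ∈ box d (n : ℝ), F x) / ((box d (n : ℝ)).card : ℝ)) atTop (𝓝 0) := by
  obtain ⟨m, hm⟩ := exists_mem_box y
  have key : ∀ (n : ℕ) (s : Finset (Vert d)), s ⊆ box d ((n + m : ℕ) : ℝ) →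
      |∑ x ∈ box d ((n + m : ℕ) : ℝ), F x - ∑ x ∈ s, F x| ≤
        M * ((box d ((n + m : ℕ) : ℝ)).card - s.card) := by
    intro n s hs
    rw [← Finset.sum_sdiff hs, add_sub_cancel_right]
    refine (Finset.abs_sum_le_sum_abs _ _).trans ?_
    refine (Finset.sum_le_card_nsmul _ _ M fun x _ => hF x).trans ?_
    rw [nsmul_eq_mul, Finset.card_sdiff_of_subset hs, Nat.cast_sub (Finset.card_le_card hs),
      mul_comm]
  have bound : ∀ n : ℕ, |(∑ x ∈ box d (n : ℝ), F (x + y)) / ((box d (n : ℝ)).card : ℝ) -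
      (∑ x ∈ box d (n : ℝ), F x) / ((box d (n : ℝ)).card : ℝ)| ≤
      2 * M * (((box d ((n + m : ℕ) : ℝ)).card : ℝ) / (box d (n : ℝ)).card - 1) := by
    intro n
    have h1 := key n (box d (n : ℝ)) (box_subset_box (Nat.le_add_right n m))
    have h2 := key n ((box d (n : ℝ)).map (addRightEmbedding y)) (by
      intro x hx
      obtain ⟨z, hz, rfl⟩ := Finset.mem_map.1 hx
      exact add_mem_box hz hm)
    rw [Finset.sum_map, Finset.card_map] at h2
    simp only [addRightEmbedding_apply] at h2
    have hc := card_box_pos d n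
    rw [← sub_div, abs_div, abs_of_pos hc, div_le_iff₀ hc, mul_assoc, sub_mul,
      div_mul_cancel₀ _ hc.ne', one_mul]
    rw [abs_le] at *
    constructor <;> linarith
  have hlim : Tendsto (fun n : ℕ => 2 * M *
      (((box d ((n + m : ℕ) : ℝ)).card : ℝ) / (box d (n : ℝ)).card - 1)) atTop (𝓝 0) := by
    have := ((tendsto_card_box_ratio d m).sub_const 1).const_mul (2 * M)
    simpa using this
  exact squeeze_zero_norm bound hlim

/-- The average of the translates of `f` over the box of radius `n`. -/
def blockAvg (d : ℕ) (n : ℕ) (f : EnvSp d → ℝ) (ω : EnvSp d) : ℝ :=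
  (∑ x ∈ box d (n : ℝ), f (shift d x ω)) / ((box d (n : ℝ)).card : ℝ)

theorem avgTo_iff {d : ℕ} {ω : EnvSp d} {f : EnvSp d → ℝ} {L : ℝ} :
    avgTo d ω f L ↔ Tendsto (fun n => blockAvg d n f ω) atTop (𝓝 L) := Iff.rfl

theorem shift_shift (d : ℕ) (x y : Vert d) (ω : EnvSp d) :
    shift d x (shift d y ω) = shift d (x + y) ω := by
  apply Subtype.ext
  funext e
  simp [shift, add_assoc]

theorem shift_zero (d : ℕ) (ω : EnvSp d) : shift d 0 ω = ω := by
  apply Subtype.ext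
  funext e
  simp [shift]

theorem measurable_shift (d : ℕ) (x : Vert d) : Measurable (shift d x) := by
  refine Measurable.subtype_mk (measurable_pi_lambda _ fun e => ?_)
  exact (measurable_pi_apply _).comp measurable_subtype_coe

theorem continuous_shift (d : ℕ) (x : Vert d) : Continuous (shift d x) := by
  refine Continuous.subtype_mk (continuous_pi fun e => ?_) _
  exact (continuous_apply _).comp continuous_subtype_val

section blockAvg

variable {d : ℕ} {n : ℕ} {f g : EnvSp d → ℝ} {ω : EnvSp d}

theorem blockAvg_add : blockAvg d n (fun ω => f ω + g ω) ω = blockAvg d n f ω + blockAvg d n g ω := by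
  simp [blockAvg, Finset.sum_add_distrib, add_div]

theorem blockAvg_sub : blockAvg d n (fun ω => f ω - g ω) ω = blockAvg d n f ω - blockAvg d n g ω := by
  simp [blockAvg, Finset.sum_sub_distrib, sub_div]

theorem blockAvg_const_mul (c : ℝ) : blockAvg d n (fun ω => c * f ω) ω = c * blockAvg d n f ω := by
  simp [blockAvg, ← Finset.mul_sum, mul_div_assoc]

theorem blockAvg_sum {ι : Type*} (s : Finset ι) (F : ι → EnvSp d → ℝ) :
    blockAvg d n (fun ω => ∑ i ∈ s, F i ω) ω = ∑ i ∈ s, blockAvg d n (F i) ω := by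
  simp only [blockAvg]
  rw [Finset.sum_comm, Finset.sum_div]

theorem blockAvg_const (c : ℝ) : blockAvg d n (fun _ => c) ω = c := by
  have := (card_box_pos d n).ne'
  simp [blockAvg]
  field_simp

theorem blockAvg_mono (h : ∀ ω, f ω ≤ g ω) : blockAvg d n f ω ≤ blockAvg d n g ω := by
  unfold blockAvg
  gcongr
  exact h _

theorem abs_blockAvg_le (h : ∀ ω, |f ω| ≤ g ω) : |blockAvg d n f ω| ≤ blockAvg d n g ω := by
  unfold blockAvg
  rw [abs_div, abs_of_pos (card_box_pos d n)]
  gcongr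
  exact (Finset.abs_sum_le_sum_abs _ _).trans (Finset.sum_le_sum fun _ _ => h _)

theorem measurable_blockAvg (hf : Measurable f) : Measurable (blockAvg d n f) := by
  unfold blockAvg
  exact (Finset.measurable_sum _ fun x _ => hf.comp (measurable_shift d x)).div_const _

theorem continuous_blockAvg (hf : Continuous f) : Continuous (blockAvg d n f) := by
  unfold blockAvg
  exact (continuous_finsetSum _ fun x _ => hf.comp (continuous_shift d x)).div_const _

theorem blockAvg_shift (y : Vert d) :
    blockAvg d n f (shift d y ω) = blockAvg d n (fun ω' => f (shift d y ω')) ω := by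
  simp [blockAvg, shift_shift, add_comm]

end blockAvg

theorem IsBdd.blockAvg {d : ℕ} {f : EnvSp d → ℝ} (hf : IsBdd d f) (n : ℕ) :
    IsBdd d (blockAvg d n f) := by
  obtain ⟨M, hM⟩ := hf
  exact ⟨M, fun ω => (abs_blockAvg_le hM).trans_eq (blockAvg_const M)⟩

theorem tendsto_blockAvg_shift_sub {d : ℕ} {f : EnvSp d → ℝ} (hf : IsBdd d f) (y : Vert d)
    (ω : EnvSp d) :
    Tendsto (fun n => blockAvg d n f (shift d y ω) - blockAvg d n f ω) atTop (𝓝 0) := by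
  obtain ⟨M, hM⟩ := hf
  have := tendsto_box_avg_translate_sub d (fun x => f (shift d x ω)) M (fun x => hM _) y
  simpa only [blockAvg, shift_shift] using this

theorem avgTo_shift_iff {d : ℕ} {f : EnvSp d → ℝ} (hf : IsBdd d f) (y : Vert d) (ω : EnvSp d)
    (L : ℝ) : avgTo d (shift d y ω) f L ↔ avgTo d ω f L := by
  have h := tendsto_blockAvg_shift_sub hf y ω
  rw [avgTo_iff, avgTo_iff]
  constructor
  · intro h2
    simpa using h2.sub h
  · intro h2
    simpa using h2.add h

/-- Indicator that the conductance at the edge `e` lies outside `[ε, 1/ε]`. -/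
def badAt (d : ℕ) (ε : ℝ) (e : EdgeIx d) (ω : EnvSp d) : ℝ :=
  if ε ≤ ω.1 e ∧ ω.1 e ≤ ε⁻¹ then 0 else 1

/-- Number of edges `(0, i)` whose conductance lies outside `[ε, 1/ε]`. -/
def badCount (d : ℕ) (ε : ℝ) (ω : EnvSp d) : ℝ := ∑ i, badAt d ε (0, i) ω

section badAt

variable {d : ℕ} {ε : ℝ} {e : EdgeIx d} {ω : EnvSp d}

theorem badAt_nonneg : 0 ≤ badAt d ε e ω := by
  unfold badAt; split_ifs <;> norm_num

theorem badAt_le_one : badAt d ε e ω ≤ 1 := by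
  unfold badAt; split_ifs <;> norm_num

theorem badAt_mono {ε' : ℝ} (h : 0 < ε') (h' : ε' ≤ ε) : badAt d ε' e ω ≤ badAt d ε e ω := by
  unfold badAt
  have := inv_anti₀ h h'
  split_ifs with h1 h2 h2 <;> norm_num
  exact h1 ⟨h'.trans h2.1, h2.2.trans this⟩

theorem badAt_shift (x : Vert d) (i : Fin d) :
    badAt d ε (0, i) (shift d x ω) = badAt d ε (x, i) ω := by
  simp [badAt, shift]

theorem measurable_badAt : Measurable (badAt d ε e) := by
  have h : Measurable fun ω : EnvSp d => ω.1 e :=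
    (measurable_pi_apply e).comp measurable_subtype_coe
  exact Measurable.ite ((measurableSet_le measurable_const h).inter
    (measurableSet_le h measurable_const)) measurable_const measurable_const

theorem measurable_badCount : Measurable (badCount d ε) :=
  Finset.measurable_sum _ fun _ _ => measurable_badAt

theorem badCount_nonneg : 0 ≤ badCount d ε ω := Finset.sum_nonneg fun _ _ => badAt_nonneg

theorem badCount_mono {ε' : ℝ} (h : 0 < ε') (h' : ε' ≤ ε) : badCount d ε' ω ≤ badCount d ε ω :=
  Finset.sum_le_sum fun _ _ => badAt_mono h h'

theorem isBdd_badCount : IsBdd d (badCount d ε) := by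
  refine ⟨d, fun ω => ?_⟩
  rw [abs_of_nonneg badCount_nonneg]
  refine (Finset.sum_le_card_nsmul _ _ 1 fun _ _ => badAt_le_one).trans ?_
  simp

theorem badAt_le_badCount (x : Vert d) (i : Fin d) :
    badAt d ε (x, i) ω ≤ badCount d ε (shift d x ω) := by
  rw [← badAt_shift]
  exact Finset.single_le_sum (f := fun i => badAt d ε (0, i) (shift d x ω))
    (fun _ _ => badAt_nonneg) (Finset.mem_univ i)

end badAt

theorem blockAvg_badCount {d n : ℕ} {ε : ℝ} {ω : EnvSp d} :
    blockAvg d n (badCount d ε) ω =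
      (∑ e ∈ box d (n : ℝ) ×ˢ Finset.univ, badAt d ε e ω) / ((box d (n : ℝ)).card : ℝ) := by
  simp only [blockAvg, badCount, badAt_shift]
  rw [Finset.sum_product]

theorem unitv_mem_box {d : ℕ} (i : Fin d) : -unitv d i ∈ box d ((1 : ℕ) : ℝ) := by
  rw [mem_box_natCast]
  intro j
  simp only [unitv, Pi.neg_apply]
  split_ifs <;> simp

theorem box_prod_subset_edgesIn (d : ℕ) (Λ : Finset (Vert d)) :
    Λ ×ˢ Finset.univ ⊆ edgesIn d Λ := by
  rintro ⟨x, i⟩ h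
  simp only [Finset.mem_product, Finset.mem_univ, and_true] at h
  exact Finset.mem_biUnion.2 ⟨x, h, by simp⟩

theorem edgesIn_subset_box_prod (d n : ℕ) :
    edgesIn d (box d (n : ℝ)) ⊆ box d ((n + 1 : ℕ) : ℝ) ×ˢ Finset.univ := by
  intro e h
  obtain ⟨x, hx, he⟩ := Finset.mem_biUnion.1 h
  simp only [Finset.mem_product, Finset.mem_univ, and_true]
  rcases Finset.mem_union.1 he with he | he
  · obtain ⟨i, -, rfl⟩ := Finset.mem_image.1 he
    exact box_subset_box (Nat.le_succ n) hx
  · obtain ⟨i, -, rfl⟩ := Finset.mem_image.1 he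
    simpa [sub_eq_add_neg] using add_mem_box hx (unitv_mem_box i)

theorem card_box_succ_le {d n : ℕ} (hn : 1 ≤ n) :
    ((box d ((n + 1 : ℕ) : ℝ)).card : ℝ) ≤ 5 ^ d * (n : ℝ) ^ d := by
  rw [card_box_natCast, ← mul_pow]
  push_cast
  have : (1 : ℝ) ≤ n := by exact_mod_cast hn
  gcongr
  linarith

theorem tempered_iff {d : ℕ} {ω : EnvSp d} :
    Tempered d ω ↔
      ∀ δ > 0, ∃ ε > 0, ∀ᶠ n : ℕ in atTop, blockAvg d n (badCount d ε) ω ≤ δ := by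
  set T : ℝ → ℕ → ℝ := fun ε n =>
    (∑ e ∈ edgesIn d (box d (n : ℝ)), badAt d ε e ω) / (n : ℝ) ^ d with hT
  have hdef : Tempered d ω ↔ Tendsto (fun ε => limsup (T ε) atTop) (𝓝[>] 0) (𝓝 0) := Iff.rfl
  have T_nonneg : ∀ ε n, 0 ≤ T ε n := fun ε n =>
    div_nonneg (Finset.sum_nonneg fun _ _ => badAt_nonneg) (by positivity)
  have T_le : ∀ ε (n : ℕ), 1 ≤ n → T ε n ≤ 5 ^ d * blockAvg d (n + 1) (badCount d ε) ω := by
    intro ε n hn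
    have hc := card_box_pos d (n + 1)
    have hn' : (0 : ℝ) < (n : ℝ) ^ d := by positivity
    have hb : 0 ≤ blockAvg d (n + 1) (badCount d ε) ω :=
      div_nonneg (Finset.sum_nonneg fun _ _ => badCount_nonneg) hc.le
    rw [hT, div_le_iff₀ hn', mul_right_comm]
    refine le_trans ?_ (mul_le_mul_of_nonneg_right (card_box_succ_le hn) hb)
    rw [blockAvg_badCount, mul_div_cancel₀ _ hc.ne']
    exact Finset.sum_le_sum_of_subset_of_nonneg (edgesIn_subset_box_prod d n)
      fun _ _ _ => badAt_nonneg
  have le_T : ∀ ε (n : ℕ), 1 ≤ n → blockAvg d n (badCount d ε) ω ≤ T ε n := by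
    intro ε n hn
    rw [blockAvg_badCount, hT]
    have hn' : (0 : ℝ) < (n : ℝ) ^ d := by positivity
    refine div_le_div₀ (Finset.sum_nonneg fun _ _ => badAt_nonneg)
      (Finset.sum_le_sum_of_subset_of_nonneg (box_prod_subset_edgesIn d _)
        fun _ _ _ => badAt_nonneg) hn' ?_
    rw [card_box_natCast]
    push_cast
    gcongr
    linarith
  have T_bdd : ∀ ε, IsBoundedUnder (· ≤ ·) atTop (T ε) := by
    intro ε
    obtain ⟨M, hM⟩ := isBdd_badCount (d := d) (ε := ε)
    refine isBoundedUnder_of_eventually_le (a := 5 ^ d * M) ?_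
    filter_upwards [eventually_ge_atTop 1] with n hn
    refine (T_le ε n hn).trans ?_
    gcongr
    exact (blockAvg_mono fun ω => (le_abs_self _).trans (hM ω)).trans_eq (blockAvg_const M)
  have T_cobdd : ∀ ε, IsCoboundedUnder (· ≤ ·) atTop (T ε) := fun ε =>
    (isBoundedUnder_of ⟨0, T_nonneg ε⟩ : IsBoundedUnder (· ≥ ·) atTop (T ε)).isCoboundedUnder_le
  rw [hdef]
  constructor
  · intro h δ hδ
    obtain ⟨ε, hε, hpos⟩ := ((h.eventually_lt_const hδ).and self_mem_nhdsWithin).exists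
    refine ⟨ε, hpos, ?_⟩
    filter_upwards [eventually_lt_of_limsup_lt hε (T_bdd ε), eventually_ge_atTop 1] with n h1 hn
    exact (le_T ε n hn).trans h1.le
  · intro h
    rw [Metric.tendsto_nhds]
    intro δ hδ
    obtain ⟨ε₀, hε₀, h0⟩ := h (δ / (2 * 5 ^ d)) (by positivity)
    filter_upwards [Ioc_mem_nhdsGT hε₀] with ε hε
    have h1 : limsup (T ε) atTop ≤ δ / 2 := by
      refine limsup_le_of_le (T_cobdd ε) ?_
      filter_upwards [(tendsto_add_atTop_nat 1).eventually h0, eventually_ge_atTop 1] with n hn hn1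
      refine (T_le ε n hn1).trans ?_
      have := (blockAvg_mono (n := n + 1) (ω := ω)
        fun ω => badCount_mono (d := d) (ω := ω) hε.1 hε.2).trans hn
      calc (5 : ℝ) ^ d * blockAvg d (n + 1) (badCount d ε) ω
          ≤ 5 ^ d * (δ / (2 * 5 ^ d)) := by gcongr
        _ = δ / 2 := by field_simp
    have h2 : 0 ≤ limsup (T ε) atTop :=
      le_limsup_of_frequently_le (Frequently.of_forall (T_nonneg ε)) (T_bdd ε)
    rw [Real.dist_eq, sub_zero, abs_of_nonneg h2]
    linarith

theorem tempered_iff_countable {d : ℕ} {ω : EnvSp d} :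
    Tempered d ω ↔ ∀ k : ℕ, ∃ m : ℕ, ∀ᶠ n : ℕ in atTop,
      blockAvg d n (badCount d (1 / ((m : ℝ) + 1))) ω ≤ 1 / ((k : ℝ) + 1) := by
  rw [tempered_iff]
  constructor
  · intro h k
    obtain ⟨ε, hε, h1⟩ := h (1 / ((k : ℝ) + 1)) (by positivity)
    obtain ⟨m, hm⟩ := exists_nat_one_div_lt hε
    refine ⟨m, h1.mono fun n hn => le_trans (blockAvg_mono fun ω => ?_) hn⟩
    exact badCount_mono (by positivity) hm.le
  · intro h δ hδ
    obtain ⟨k, hk⟩ := exists_nat_one_div_lt hδ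
    obtain ⟨m, hm⟩ := h k
    exact ⟨_, Nat.one_div_pos_of_nat, hm.mono fun n hn => hn.trans hk.le⟩

theorem measurableSet_tempered (d : ℕ) : MeasurableSet {ω : EnvSp d | Tempered d ω} := by
  simp only [tempered_iff_countable, eventually_atTop]
  refine measurableSet_setOfPred.2 ?_
  refine Measurable.forall fun k => Measurable.exists fun m => Measurable.exists fun N =>
    Measurable.forall fun n => Measurable.forall fun _ => ?_
  exact measurableSet_setOfPred.1
    (measurableSet_le (measurable_blockAvg measurable_badCount) measurable_const)

theorem Tempered.shift {d : ℕ} {ω : EnvSp d} (h : Tempered d ω) (y : Vert d) :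
    Tempered d (shift d y ω) := by
  rw [tempered_iff] at h ⊢
  intro δ hδ
  obtain ⟨ε, hε, h1⟩ := h (δ / 2) (by positivity)
  refine ⟨ε, hε, ?_⟩
  filter_upwards [h1, (tendsto_blockAvg_shift_sub (isBdd_badCount (ε := ε)) y ω).eventually_lt_const
    (half_pos hδ)] with n hn hn2
  linarith

/-- In a tempered configuration a fixed edge is rarely bad along translates. -/
theorem Tempered.eventually_badAt_le {d : ℕ} {ω : EnvSp d} (h : Tempered d ω) (e : EdgeIx d)
    {δ : ℝ} (hδ : 0 < δ) :
    ∃ ε > 0, ∀ᶠ n : ℕ in atTop, blockAvg d n (badAt d ε e) ω ≤ δ := by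
  obtain ⟨ε, hε, h1⟩ := tempered_iff.1 (h.shift e.1) δ hδ
  refine ⟨ε, hε, h1.mono fun n hn => le_trans ?_ hn⟩
  rw [blockAvg_shift]
  exact blockAvg_mono fun ω => badAt_le_badCount e.1 e.2

/-- A compact space containing the environment space. -/
abbrev CompactEnv (d : ℕ) := EdgeIx d → EReal

/-- The inclusion of the environment space into its compactification. -/
def compactEmb (d : ℕ) (ω : EnvSp d) : CompactEnv d := fun e => (ω.1 e : EReal)

theorem isEmbedding_compactEmb (d : ℕ) : IsEmbedding (compactEmb d) :=
  (IsEmbedding.piMap fun _ : EdgeIx d => EReal.isEmbedding_coe).comp IsEmbedding.subtypeVal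

theorem range_compactEmb (d : ℕ) : Set.range (compactEmb d) = ⋂ e, {k | 0 < k e ∧ k e < ⊤} := by
  ext k
  simp only [Set.mem_range, Set.mem_iInter, Set.mem_ofPred_eq]
  constructor
  · rintro ⟨ω, rfl⟩ e
    exact ⟨EReal.coe_pos.2 (ω.2 e), EReal.coe_lt_top _⟩
  · intro h
    have h2 : ∀ e, ((k e).toReal : EReal) = k e := fun e =>
      EReal.coe_toReal (h e).2.ne (ne_bot_of_gt (h e).1)
    refine ⟨⟨fun e => (k e).toReal, fun e => ?_⟩, funext h2⟩
    have := (h e).1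
    rw [← h2 e] at this
    exact_mod_cast this

theorem measurableEmbedding_compactEmb (d : ℕ) : MeasurableEmbedding (compactEmb d) := by
  refine (isEmbedding_compactEmb d).measurableEmbedding ?_
  rw [range_compactEmb]
  refine MeasurableSet.iInter fun e => ?_
  exact (measurable_pi_apply e) measurableSet_Ioo

instance (d : ℕ) : HasOuterApproxClosed (EnvSp d) := by
  have := (isEmbedding_compactEmb d).metrizableSpace
  let := TopologicalSpace.metrizableSpaceMetric (EnvSp d)
  infer_instance

/-- The restriction to the environment space of a continuous function on the compactification. -/
def testFn (d : ℕ) (g : C(CompactEnv d, ℝ)) (ω : EnvSp d) : ℝ := g (compactEmb d ω)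

theorem continuous_testFn {d : ℕ} (g : C(CompactEnv d, ℝ)) : Continuous (testFn d g) :=
  g.continuous.comp (isEmbedding_compactEmb d).continuous

theorem isBdd_testFn {d : ℕ} (g : C(CompactEnv d, ℝ)) : IsBdd d (testFn d g) :=
  ⟨‖g‖, fun _ => g.norm_coe_le_norm _⟩

theorem IsBdd.integrable {d : ℕ} {f : EnvSp d → ℝ} (hf : IsBdd d f) (hm : Measurable f)
    (P : Measure (EnvSp d)) [IsFiniteMeasure P] : Integrable f P := by
  obtain ⟨M, hM⟩ := hf
  exact Integrable.of_bound hm.aestronglyMeasurable M (Eventually.of_forall hM)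

theorem isBdd_of_isLocalFn {d : ℕ} {f : EnvSp d → ℝ} (hf : Continuous f) (hl : IsLocalFn d f) :
    IsBdd d f := by
  classical
  obtain ⟨B, hB, a, b, ha, hab⟩ := hl
  let C : Set (EdgeIx d → ℝ) :=
    Set.univ.pi fun e => if e ∈ B then Set.Icc a b else {1}
  have hC : IsCompact C := isCompact_univ_pi fun e => by
    split_ifs
    · exact isCompact_Icc
    · exact isCompact_singleton
  have hpos : ∀ u ∈ C, ∀ e, 0 < u e := by
    intro u hu e
    have := hu e (Set.mem_univ e)
    dsimp only at this
    split_ifs at this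
    · exact ha.trans_le this.1
    · rw [Set.mem_singleton_iff.1 this]; exact one_pos
  have hsub : C ⊆ Set.range (Subtype.val : EnvSp d → EdgeIx d → ℝ) :=
    fun u hu => ⟨⟨u, hpos u hu⟩, rfl⟩
  have hC' : IsCompact ((↑) ⁻¹' C : Set (EnvSp d)) := by
    rw [IsEmbedding.subtypeVal.isCompact_iff, Set.image_preimage_eq_inter_range,
      Set.inter_eq_left.2 hsub]
    exact hC
  obtain ⟨M, hM⟩ := hC'.exists_bound_of_continuousOn hf.continuousOn
  refine ⟨max M 0, fun ω => ?_⟩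
  by_cases h : ∃ e ∈ B, ω.1 e < a ∨ b < ω.1 e
  · rw [hab ω h]; simp
  · push Not at h
    let ω' : EnvSp d := ⟨fun e => if e ∈ B then ω.1 e else 1, fun e => by
      dsimp only
      split_ifs
      exacts [ω.2 e, one_pos]⟩
    have h1 : f ω = f ω' := hB _ _ fun e he => by simp [ω', he]
    rw [h1]
    refine (hM ω' fun e _ => ?_).trans (le_max_left _ _)
    by_cases he : e ∈ B
    · simpa [ω', he] using h e he
    · simp [ω', he]

/-- The empirical measure of the translates of `ω` over a box. -/
def empirical (d n : ℕ) (ω : EnvSp d) : Measure (EnvSp d) :=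
  ((box d (n : ℝ)).card : ℝ≥0∞)⁻¹ • ∑ x ∈ box d (n : ℝ), Measure.dirac (shift d x ω)

instance (d n : ℕ) (ω : EnvSp d) : IsProbabilityMeasure (empirical d n ω) := by
  constructor
  have h : ((box d (n : ℝ)).card : ℝ≥0∞) ≠ 0 := by
    have := card_box_pos d n
    exact_mod_cast this.ne'
  simp [empirical, ENNReal.inv_mul_cancel h (ENNReal.natCast_ne_top _)]

theorem integral_empirical {d n : ℕ} {ω : EnvSp d} {f : EnvSp d → ℝ} (hf : Measurable f) :
    ∫ ω', f ω' ∂(empirical d n ω) = blockAvg d n f ω := by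
  rw [empirical, integral_smul_measure, integral_finsetSum_measure]
  · simp only [integral_dirac' _ _ hf.stronglyMeasurable, blockAvg, smul_eq_mul]
    rw [ENNReal.toReal_inv, ENNReal.toReal_natCast, div_eq_inv_mul]
  · intro x _
    exact integrable_dirac' hf.stronglyMeasurable (by simp)

/-- The empirical measure as a probability measure on the compactification. -/
def empiricalCompact (d n : ℕ) (ω : EnvSp d) : ProbabilityMeasure (CompactEnv d) :=
  ⟨(empirical d n ω).map (compactEmb d),
    Measure.isProbabilityMeasure_map (measurableEmbedding_compactEmb d).measurable.aemeasurable⟩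

theorem integral_empiricalCompact {d n : ℕ} {ω : EnvSp d} (g : C(CompactEnv d, ℝ)) :
    ∫ k, g k ∂(empiricalCompact d n ω : Measure (CompactEnv d)) = blockAvg d n (testFn d g) ω := by
  rw [empiricalCompact, ProbabilityMeasure.coe_mk, (measurableEmbedding_compactEmb d).integral_map]
  exact integral_empirical (continuous_testFn g).measurable

theorem tendsto_empiricalCompact_of_integral {d : ℕ} {ω : EnvSp d}
    (Q : ProbabilityMeasure (CompactEnv d))
    (h : ∀ g : C(CompactEnv d, ℝ),
      Tendsto (fun n => blockAvg d n (testFn d g) ω) atTop (𝓝 (∫ k, g k ∂(Q : Measure _)))) :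
    Tendsto (fun n => empiricalCompact d n ω) atTop (𝓝 Q) := by
  rw [ProbabilityMeasure.tendsto_iff_forall_integral_tendsto]
  intro f
  have := h f.toContinuousMap
  simp only [← integral_empiricalCompact] at this
  exact this

/-- Convergence of the block averages of all test functions identifies the law. -/
theorem isEnvLaw_of_testFn {d : ℕ} {ω : EnvSp d} {P : Measure (EnvSp d)} [IsProbabilityMeasure P]
    (h : ∀ g : C(CompactEnv d, ℝ), avgTo d ω (testFn d g) (∫ ω', testFn d g ω' ∂P)) :
    IsEnvLaw d ω P := by
  refine ⟨inferInstance, fun f hf hb => ?_⟩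
  have hemb := measurableEmbedding_compactEmb d
  let Q : ProbabilityMeasure (CompactEnv d) :=
    ⟨P.map (compactEmb d), Measure.isProbabilityMeasure_map hemb.measurable.aemeasurable⟩
  have hQ : Tendsto (fun n => empiricalCompact d n ω) atTop (𝓝 Q) := by
    refine tendsto_empiricalCompact_of_integral Q fun g => ?_
    have : ∫ k, g k ∂(Q : Measure (CompactEnv d)) = ∫ ω', testFn d g ω' ∂P :=
      hemb.integral_map _
    rw [this]
    exact h g
  let R : ProbabilityMeasure (EnvSp d) := ⟨P, inferInstance⟩
  let E : ℕ → ProbabilityMeasure (EnvSp d) := fun n => ⟨empirical d n ω, inferInstance⟩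
  have hR : Tendsto E atTop (𝓝 R) := by
    refine tendsto_of_forall_isOpen_le_liminf_nat' fun G hG => ?_
    obtain ⟨U, hU, rfl⟩ := (isEmbedding_compactEmb d).isOpen_iff.1 hG
    have := ProbabilityMeasure.le_liminf_measure_open_of_tendsto hQ hU
    simpa only [empiricalCompact, Q, R, E, ProbabilityMeasure.coe_mk, hemb.map_apply] using this
  obtain ⟨M, hM⟩ := hb
  have := (ProbabilityMeasure.tendsto_iff_forall_integral_tendsto.1 hR)
    (BoundedContinuousFunction.ofNormedAddCommGroup f hf M hM)
  simp only [R, E, ProbabilityMeasure.coe_mk, BoundedContinuousFunction.coe_ofNormedAddCommGroup,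
    integral_empirical hf.measurable] at this
  exact this

theorem IsEnvLaw.unique {d : ℕ} {ω : EnvSp d} {P Q : Measure (EnvSp d)} (hP : IsEnvLaw d ω P)
    (hQ : IsEnvLaw d ω Q) : P = Q := by
  have := hP.1
  have := hQ.1
  refine ext_of_forall_integral_eq_of_IsFiniteMeasure fun f => ?_
  have hb : IsBdd d f := ⟨‖f‖, f.norm_coe_le_norm⟩
  exact tendsto_nhds_unique (hP.2 f f.continuous hb) (hQ.2 f f.continuous hb)

theorem IsEnvLaw.averaging {d : ℕ} {ω : EnvSp d} {P : Measure (EnvSp d)} (hP : IsEnvLaw d ω P) :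
    Averaging d ω := fun f hf hl => ⟨_, hP.2 f hf (isBdd_of_isLocalFn hf hl)⟩

/-- In a tempered configuration, any limit of empirical measures on the compactification
is carried by the environment space. -/
theorem Tempered.ae_mem_range {d : ℕ} {ω : EnvSp d} (hT : Tempered d ω)
    {Q : ProbabilityMeasure (CompactEnv d)}
    (hQ : Tendsto (fun n => empiricalCompact d n ω) atTop (𝓝 Q)) :
    ∀ᵐ k ∂(Q : Measure (CompactEnv d)), k ∈ Set.range (compactEmb d) := by
  have hemb := measurableEmbedding_compactEmb d
  rw [range_compactEmb]
  simp only [Set.mem_iInter]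
  refine ae_all_iff.2 fun e => ?_
  rw [ae_iff]
  refine le_antisymm (le_of_forall_pos_le_add fun δ hδ => ?_) (zero_le)
  rw [zero_add]
  rcases eq_or_ne δ ∞ with rfl | hδ'
  · exact le_top
  obtain ⟨ε, hε, hev⟩ := hT.eventually_badAt_le e (ENNReal.toReal_pos hδ.ne' hδ')
  let U : Set (CompactEnv d) := {k | k e < (ε : EReal)} ∪ {k | ((ε⁻¹ : ℝ) : EReal) < k e}
  have hU : IsOpen U := (isOpen_lt (continuous_apply e) continuous_const).union
    (isOpen_lt continuous_const (continuous_apply e))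
  have hsub : {k : CompactEnv d | ¬ k ∈ {k : CompactEnv d | 0 < k e ∧ k e < ⊤}} ⊆ U := by
    intro k hk
    simp only [Set.mem_ofPred_eq, not_and_or, not_lt, top_le_iff] at hk
    rcases hk with hk | hk
    · exact Or.inl (hk.trans_lt (by exact_mod_cast hε))
    · refine Or.inr ?_
      simp only [Set.mem_ofPred_eq, hk]
      exact EReal.coe_lt_top _
  refine (measure_mono hsub).trans
    ((ProbabilityMeasure.le_liminf_measure_open_of_tendsto hQ hU).trans ?_)
  refine liminf_le_of_frequently_le' (hev.mono fun n hn => ?_).frequently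
  have hpre : compactEmb d ⁻¹' U = {ω' | badAt d ε e ω' = 1} := by
    ext ω'
    simp only [U, compactEmb, badAt, Set.mem_preimage, Set.mem_union, Set.mem_ofPred_eq,
      EReal.coe_lt_coe_iff]
    split_ifs with h
    · simp [h.1, h.2]
    · simpa [← not_le, or_iff_not_imp_left] using h
  have hms : MeasurableSet {ω' : EnvSp d | badAt d ε e ω' = 1} :=
    measurable_badAt (measurableSet_singleton 1)
  rw [empiricalCompact, ProbabilityMeasure.coe_mk, hemb.map_apply, hpre,
    ← ENNReal.ofReal_toReal (measure_ne_top (empirical d n ω) _)]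
  refine ENNReal.ofReal_le_of_le_toReal (le_trans (le_of_eq ?_) hn)
  have hind : badAt d ε e = Set.indicator {ω' : EnvSp d | badAt d ε e ω' = 1} 1 := by
    funext ω'
    simp only [Set.indicator, Set.mem_ofPred_eq, badAt]
    split_ifs <;> simp_all
  rw [← integral_empirical measurable_badAt]
  conv_rhs => rw [hind]
  rw [integral_indicator_one hms]
  rfl

/-- Existence of the law of a tempered configuration along which all test functions average. -/
theorem Tempered.exists_isEnvLaw {d : ℕ} {ω : EnvSp d} (hT : Tempered d ω)
    (h : ∀ g : C(CompactEnv d, ℝ), ∃ L, avgTo d ω (testFn d g) L) :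
    ∃ P, IsEnvLaw d ω P := by
  have hemb := measurableEmbedding_compactEmb d
  obtain ⟨Q, -, hQ⟩ := isCompact_univ.exists_mapClusterPt (f := atTop)
    (u := fun n => empiricalCompact d n ω) (by simp)
  have hlim : ∀ g : C(CompactEnv d, ℝ),
      Tendsto (fun n => blockAvg d n (testFn d g) ω) atTop (𝓝 (∫ k, g k ∂(Q : Measure _))) := by
    intro g
    obtain ⟨L, hL⟩ := h g
    have hcont : Continuous fun R : ProbabilityMeasure (CompactEnv d) =>
        ∫ k, g k ∂(R : Measure (CompactEnv d)) :=
      ProbabilityMeasure.continuous_integral_boundedContinuousFunction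
        (BoundedContinuousFunction.mkOfCompact g)
    have hc := hQ.continuousAt_comp hcont.continuousAt
    simp only [Function.comp_def, integral_empiricalCompact] at hc
    have : Tendsto (fun n => blockAvg d n (testFn d g) ω) atTop (𝓝 L) := hL
    obtain ⟨ψ, hψ, hψ'⟩ := hc.tendsto_subseq
    rwa [tendsto_nhds_unique (this.comp hψ.tendsto_atTop) hψ'] at this
  have hQ' := tendsto_empiricalCompact_of_integral Q hlim
  have hr := hT.ae_mem_range hQ'
  have hmap : ((Q : Measure (CompactEnv d)).comap (compactEmb d)).map (compactEmb d) = Q := by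
    rw [hemb.map_comap, Measure.restrict_eq_self_of_ae_mem hr]
  have : IsProbabilityMeasure ((Q : Measure (CompactEnv d)).comap (compactEmb d)) := by
    constructor
    rw [← Set.preimage_univ (f := compactEmb d), ← hemb.map_apply, hmap, measure_univ]
  refine ⟨(Q : Measure (CompactEnv d)).comap (compactEmb d), isEnvLaw_of_testFn fun g => ?_⟩
  have h1 : ∫ ω', testFn d g ω' ∂((Q : Measure (CompactEnv d)).comap (compactEmb d)) =
      ∫ k, g k ∂(Q : Measure (CompactEnv d)) := by
    rw [← hmap, hemb.integral_map, hmap]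
    rfl
  rw [h1]
  exact hlim g

/-- Convergence of block averages is stable under approximation in upper mean. -/
theorem exists_avgTo_of_approx {d : ℕ} {ω : EnvSp d} {f : EnvSp d → ℝ}
    (h : ∀ δ > 0, ∃ f' L, avgTo d ω f' L ∧
      ∀ᶠ n : ℕ in atTop, |blockAvg d n f ω - blockAvg d n f' ω| ≤ δ) :
    ∃ L, avgTo d ω f L := by
  refine cauchySeq_tendsto_of_complete (u := fun n : ℕ => blockAvg d n f ω)
    (Metric.cauchySeq_iff'.2 fun ε hε => ?_)
  obtain ⟨f', L, hL, hev⟩ := h (ε / 8) (by positivity)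
  have h2 : ∀ᶠ n : ℕ in atTop, |blockAvg d n f' ω - L| < ε / 8 :=
    (Metric.tendsto_nhds.1 (avgTo_iff.1 hL)) (ε / 8) (by positivity)
  obtain ⟨N, hN⟩ := eventually_atTop.1 (hev.and h2)
  refine ⟨N, fun n hn => ?_⟩
  obtain ⟨a1, a2⟩ := hN n hn
  obtain ⟨b1, b2⟩ := hN N le_rfl
  rw [abs_le] at a1 b1
  rw [abs_lt] at a2 b2
  rw [Real.dist_eq, abs_lt]
  constructor <;> linarith [a1.1, a1.2, b1.1, b1.2, a2.1, a2.2, b2.1, b2.2]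

/-- A continuous cutoff, equal to one on `[ε, ε⁻¹]`. -/
def cutoff (ε c : ℝ) : ℝ := max 0 (min 1 (min (2 * c / ε - 1) (2 - ε * c)))

theorem continuous_cutoff (ε : ℝ) : Continuous (cutoff ε) := by
  unfold cutoff
  fun_prop

theorem cutoff_nonneg (ε c : ℝ) : 0 ≤ cutoff ε c := le_max_left _ _

theorem cutoff_le_one (ε c : ℝ) : cutoff ε c ≤ 1 := max_le zero_le_one (min_le_left _ _)

theorem cutoff_eq_one {ε c : ℝ} (hε : 0 < ε) (h : ε ≤ c) (h' : c ≤ ε⁻¹) : cutoff ε c = 1 := by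
  have h1 : 1 ≤ 2 * c / ε - 1 := by
    have : 2 ≤ 2 * c / ε := by rw [le_div_iff₀ hε]; linarith
    linarith
  have h2 : 1 ≤ 2 - ε * c := by
    have : ε * c ≤ ε * ε⁻¹ := by gcongr
    rw [mul_inv_cancel₀ hε.ne'] at this
    linarith
  rw [cutoff, min_eq_left (le_min h1 h2), max_eq_right zero_le_one]

theorem cutoff_eq_zero {ε c : ℝ} (hε : 0 < ε) (h : c < ε / 2 ∨ 2 / ε < c) : cutoff ε c = 0 := by
  refine max_eq_left ?_
  rcases h with h | h
  · refine (min_le_right _ _).trans ((min_le_left _ _).trans ?_)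
    have : 2 * c / ε ≤ 1 := by rw [div_le_one hε]; linarith
    linarith
  · refine (min_le_right _ _).trans ((min_le_right _ _).trans ?_)
    rw [div_lt_iff₀ hε] at h
    linarith

/-- Continuous functions on the compactification depending on finitely many coordinates. -/
def cylinderAlgebra (d : ℕ) : Subalgebra ℝ C(CompactEnv d, ℝ) where
  carrier := {g | ∃ B : Finset (EdgeIx d), ∀ k k' : CompactEnv d, (∀ e ∈ B, k e = k' e) → g k = g k'}
  mul_mem' := by
    rintro f g ⟨B, hB⟩ ⟨C, hC⟩
    refine ⟨B ∪ C, fun k k' h => ?_⟩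
    rw [ContinuousMap.mul_apply, ContinuousMap.mul_apply,
      hB k k' fun e he => h e (Finset.mem_union_left _ he),
      hC k k' fun e he => h e (Finset.mem_union_right _ he)]
  add_mem' := by
    rintro f g ⟨B, hB⟩ ⟨C, hC⟩
    refine ⟨B ∪ C, fun k k' h => ?_⟩
    rw [ContinuousMap.add_apply, ContinuousMap.add_apply,
      hB k k' fun e he => h e (Finset.mem_union_left _ he),
      hC k k' fun e he => h e (Finset.mem_union_right _ he)]
  algebraMap_mem' r := ⟨∅, fun _ _ _ => rfl⟩

theorem cylinderAlgebra_separatesPoints (d : ℕ) : (cylinderAlgebra d).SeparatesPoints := by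
  intro k k' hne
  obtain ⟨e, he⟩ := Function.ne_iff.1 hne
  obtain ⟨φ, h0, h1, -⟩ := exists_continuous_zero_one_of_isClosed
    (isClosed_singleton (x := k e)) (isClosed_singleton (x := k' e))
    (Set.disjoint_singleton.2 he)
  let g : C(CompactEnv d, ℝ) := ⟨fun k => φ (k e), φ.continuous.comp (continuous_apply e)⟩
  refine ⟨g, ⟨g, ⟨{e}, fun a b hab => ?_⟩, rfl⟩, ?_⟩
  · simp [g, hab e (Finset.mem_singleton_self e)]
  · have a : φ (k e) = 0 := h0 rfl
    have b : φ (k' e) = 1 := h1 rfl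
    simp [g, a, b]

theorem exists_cylinder_near {d : ℕ} (g : C(CompactEnv d, ℝ)) {δ : ℝ} (hδ : 0 < δ) :
    ∃ g' ∈ cylinderAlgebra d, ‖g - g'‖ ≤ δ := by
  have h : g ∈ (cylinderAlgebra d).topologicalClosure := by
    rw [ContinuousMap.subalgebra_topologicalClosure_eq_top_of_separatesPoints _
      (cylinderAlgebra_separatesPoints d)]
    trivial
  obtain ⟨g', hg', hd⟩ := Metric.mem_closure_iff.1 (show g ∈ closure (cylinderAlgebra d : Set _)
    from h) δ hδ
  exact ⟨g', hg', by rw [← dist_eq_norm]; exact hd.le⟩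

theorem abs_testFn_sub_le {d : ℕ} (g g' : C(CompactEnv d, ℝ)) (ω : EnvSp d) :
    |testFn d g ω - testFn d g' ω| ≤ ‖g - g'‖ :=
  (g - g').norm_coe_le_norm (compactEmb d ω)

theorem abs_blockAvg_testFn_sub_le {d n : ℕ} (g g' : C(CompactEnv d, ℝ)) (ω : EnvSp d) :
    |blockAvg d n (testFn d g) ω - blockAvg d n (testFn d g') ω| ≤ ‖g - g'‖ := by
  rw [← blockAvg_sub]
  exact (abs_blockAvg_le (abs_testFn_sub_le g g')).trans_eq (blockAvg_const _)

theorem Tempered.exists_avgTo_of_mem_cylinder {d : ℕ} {ω : EnvSp d} (hT : Tempered d ω)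
    (hA : Averaging d ω) {g : C(CompactEnv d, ℝ)} (hg : g ∈ cylinderAlgebra d) :
    ∃ L, avgTo d ω (testFn d g) L := by
  obtain ⟨B, hB⟩ := hg
  refine exists_avgTo_of_approx fun δ hδ => ?_
  have hη : 0 < δ / ((‖g‖ + 1) * (B.card + 1)) := by positivity
  choose ε hε hev using fun e => hT.eventually_badAt_le e hη
  obtain ⟨ε₀, hε₀, hle⟩ : ∃ ε₀ > 0, ∀ e ∈ B, ε₀ ≤ ε e := by
    rcases B.eq_empty_or_nonempty with rfl | hne
    · exact ⟨1, one_pos, by simp⟩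
    · exact ⟨B.inf' hne ε, (Finset.lt_inf'_iff hne).2 fun e _ => hε e,
        fun e he => Finset.inf'_le _ he⟩
  let f' : EnvSp d → ℝ := fun ω' => testFn d g ω' * ∏ e ∈ B, cutoff ε₀ (ω'.1 e)
  have hf' : Continuous f' := (continuous_testFn g).mul <| continuous_finsetProd _ fun e _ =>
    (continuous_cutoff ε₀).comp ((continuous_apply e).comp continuous_subtype_val)
  have hl : IsLocalFn d f' := by
    refine ⟨B, fun ω₁ ω₂ h => ?_, ε₀ / 2, 2 / ε₀, by positivity, fun ω' ⟨e, he, h⟩ => ?_⟩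
    · simp only [f', testFn]
      congr 1
      · exact hB _ _ fun e he => by simp [compactEmb, h e he]
      · exact Finset.prod_congr rfl fun e he => by rw [h e he]
    · simp only [f']
      rw [Finset.prod_eq_zero he (cutoff_eq_zero hε₀ h), mul_zero]
  obtain ⟨L, hL⟩ := hA f' hf' hl
  refine ⟨f', L, hL, ?_⟩
  have hpt : ∀ ω', |testFn d g ω' - f' ω'| ≤ ‖g‖ * ∑ e ∈ B, badAt d ε₀ e ω' := by
    intro ω'
    have h1 : |testFn d g ω'| ≤ ‖g‖ := g.norm_coe_le_norm _
    have h2 : testFn d g ω' - f' ω' = testFn d g ω' * (1 - ∏ e ∈ B, cutoff ε₀ (ω'.1 e)) := by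
      simp only [f']; ring
    rw [h2, abs_mul]
    refine mul_le_mul h1 ?_ (abs_nonneg _) (norm_nonneg _)
    have p0 : 0 ≤ ∏ e ∈ B, cutoff ε₀ (ω'.1 e) := Finset.prod_nonneg fun _ _ => cutoff_nonneg _ _
    have p1 : ∏ e ∈ B, cutoff ε₀ (ω'.1 e) ≤ 1 :=
      Finset.prod_le_one (fun _ _ => cutoff_nonneg _ _) fun _ _ => cutoff_le_one _ _
    rw [abs_of_nonneg (by linarith)]
    by_cases hall : ∀ e ∈ B, ε₀ ≤ ω'.1 e ∧ ω'.1 e ≤ ε₀⁻¹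
    · rw [Finset.prod_congr rfl fun e he => cutoff_eq_one hε₀ (hall e he).1 (hall e he).2]
      simpa using Finset.sum_nonneg fun e _ => badAt_nonneg
    · simp only [not_forall] at hall
      obtain ⟨e, he, hbad⟩ := hall
      have hb : badAt d ε₀ e ω' = 1 := if_neg hbad
      have := Finset.single_le_sum (f := fun e => badAt d ε₀ e ω') (fun _ _ => badAt_nonneg) he
      linarith
  have hev' : ∀ᶠ n : ℕ in atTop, ∀ e ∈ B, blockAvg d n (badAt d ε₀ e) ω ≤
      δ / ((‖g‖ + 1) * (B.card + 1)) := by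
    rw [eventually_all_finset]
    exact fun e he => (hev e).mono fun n hn =>
      (blockAvg_mono fun ω => badAt_mono hε₀ (hle e he)).trans hn
  filter_upwards [hev'] with n hn
  rw [← blockAvg_sub]
  refine (abs_blockAvg_le hpt).trans ?_
  rw [blockAvg_const_mul, blockAvg_sum]
  have hs := Finset.sum_le_sum hn
  rw [Finset.sum_const, nsmul_eq_mul] at hs
  calc _ ≤ ‖g‖ * (B.card * (δ / ((‖g‖ + 1) * (B.card + 1)))) := by gcongr
    _ ≤ (‖g‖ + 1) * ((B.card + 1) * (δ / ((‖g‖ + 1) * (B.card + 1)))) := by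
        gcongr <;> linarith
    _ = δ := by field_simp

theorem Tempered.exists_avgTo_testFn {d : ℕ} {ω : EnvSp d} (hT : Tempered d ω)
    (hA : Averaging d ω) (g : C(CompactEnv d, ℝ)) : ∃ L, avgTo d ω (testFn d g) L := by
  refine exists_avgTo_of_approx fun δ hδ => ?_
  obtain ⟨g', hg', hd⟩ := exists_cylinder_near g hδ
  obtain ⟨L, hL⟩ := hT.exists_avgTo_of_mem_cylinder hA hg'
  exact ⟨_, L, hL, .of_forall fun n => (abs_blockAvg_testFn_sub_le g g' ω).trans hd⟩

/-- A dense sequence of continuous functions on the compactification. -/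
def denseFn (d : ℕ) : ℕ → C(CompactEnv d, ℝ) := TopologicalSpace.denseSeq _

theorem exists_denseFn_near {d : ℕ} (g : C(CompactEnv d, ℝ)) {δ : ℝ} (hδ : 0 < δ) :
    ∃ j, ‖g - denseFn d j‖ ≤ δ := by
  obtain ⟨j, hj⟩ := (TopologicalSpace.denseRange_denseSeq C(CompactEnv d, ℝ)).exists_dist_lt g hδ
  exact ⟨j, by rw [← dist_eq_norm]; exact hj.le⟩

theorem exists_avgTo_testFn_of_denseFn {d : ℕ} {ω : EnvSp d}
    (h : ∀ j, ∃ L, avgTo d ω (testFn d (denseFn d j)) L) (g : C(CompactEnv d, ℝ)) :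
    ∃ L, avgTo d ω (testFn d g) L := by
  refine exists_avgTo_of_approx fun δ hδ => ?_
  obtain ⟨j, hd⟩ := exists_denseFn_near g hδ
  obtain ⟨L, hL⟩ := h j
  exact ⟨_, L, hL, .of_forall fun n => (abs_blockAvg_testFn_sub_le g _ ω).trans hd⟩

/-- Averages along a dense sequence of test functions determine the law. -/
theorem isEnvLaw_of_denseFn {d : ℕ} {ω : EnvSp d} {P : Measure (EnvSp d)} [IsProbabilityMeasure P]
    (h : ∀ j, avgTo d ω (testFn d (denseFn d j)) (∫ ω', testFn d (denseFn d j) ω' ∂P)) :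
    IsEnvLaw d ω P := by
  refine isEnvLaw_of_testFn fun g => ?_
  rw [avgTo_iff, Metric.tendsto_nhds]
  intro ε hε
  obtain ⟨j, hd⟩ := exists_denseFn_near g (δ := ε / 4) (by positivity)
  have hi : |∫ ω', testFn d g ω' ∂P - ∫ ω', testFn d (denseFn d j) ω' ∂P| ≤ ε / 4 := by
    rw [← integral_sub ((isBdd_testFn g).integrable (continuous_testFn g).measurable P)
      ((isBdd_testFn _).integrable (continuous_testFn _).measurable P)]
    have := norm_integral_le_of_norm_le_const (μ := P)
      (f := fun ω' => testFn d g ω' - testFn d (denseFn d j) ω') (.of_forall fun ω' =>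
      (abs_testFn_sub_le g (denseFn d j) ω').trans hd)
    simpa using this
  filter_upwards [(Metric.tendsto_nhds.1 (avgTo_iff.1 (h j))) (ε / 4) (by positivity)] with n hn
  have h1 := (abs_blockAvg_testFn_sub_le (n := n) g (denseFn d j) ω).trans hd
  rw [Real.dist_eq] at *
  rw [abs_le] at h1 hi
  rw [abs_lt] at hn ⊢
  constructor <;> linarith [h1.1, h1.2, hi.1, hi.2, hn.1, hn.2]

theorem mem_closedBall_vert {d n : ℕ} {a b : Vert d} :
    a ∈ Metric.closedBall b (n : ℝ) ↔ a - b ∈ box d (n : ℝ) := by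
  rw [Metric.mem_closedBall, dist_pi_le_iff (Nat.cast_nonneg n), mem_box_natCast]
  simp only [Int.dist_eq, Pi.sub_apply]
  exact forall_congr' fun i => by exact_mod_cast Iff.rfl

theorem card_box_mul_le (d m n : ℕ) (hm : 1 ≤ m) :
    ((box d ((m * n : ℕ) : ℝ)).card : ℝ) ≤ (m : ℝ) ^ d * (box d (n : ℝ)).card := by
  rw [card_box_natCast, card_box_natCast]
  push_cast
  rw [← mul_pow]
  have : (1 : ℝ) ≤ m := by exact_mod_cast hm
  gcongr
  linarith

/-- The discrete Hardy–Littlewood maximal inequality on `ℤ^d`. -/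
theorem card_mul_le_of_forall_exists_box {d N : ℕ} {u : Vert d → ℝ} (hu : ∀ x, 0 ≤ u x) {a : ℝ}
    (ha : 0 ≤ a) {S : Finset (Vert d)} (hS : S ⊆ box d (N : ℝ))
    (h : ∀ x ∈ S, ∃ n ≤ N, a * (box d (n : ℝ)).card ≤ ∑ y ∈ box d (n : ℝ), u (y + x)) :
    a * S.card ≤ 5 ^ d * ∑ z ∈ box d ((2 * N : ℕ) : ℝ), u z := by
  classical
  have h' : ∀ x, ∃ n : ℕ, x ∈ S →
      n ≤ N ∧ a * (box d (n : ℝ)).card ≤ ∑ y ∈ box d (n : ℝ), u (y + x) := by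
    intro x
    by_cases hx : x ∈ S
    · obtain ⟨n, hn⟩ := h x hx
      exact ⟨n, fun _ => hn⟩
    · exact ⟨0, fun h => absurd h hx⟩
  choose r hr using h'
  obtain ⟨T, hTS, hdisj, hcov⟩ := Vitali.exists_disjoint_subfamily_covering_enlargement_closedBall
    (S : Set (Vert d)) id (fun x => (r x : ℝ)) N
    (fun x hx => by exact_mod_cast (hr x hx).1) 5 (by norm_num)
  lift T to Finset (Vert d) using S.finite_toSet.subset hTS
  have hTS' : T ⊆ S := by exact_mod_cast hTS
  let ball : Vert d → ℕ → Finset (Vert d) := fun b n =>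
    (box d (n : ℝ)).map (addRightEmbedding b)
  have hball : ∀ b n z, z ∈ ball b n ↔ z ∈ Metric.closedBall b (n : ℝ) := by
    intro b n z
    rw [mem_closedBall_vert]
    simp only [ball, Finset.mem_map, addRightEmbedding_apply]
    exact ⟨by rintro ⟨y, hy, rfl⟩; simpa using hy, fun hz => ⟨_, hz, by simp⟩⟩
  have hsub : S ⊆ T.biUnion fun b => ball b (5 * r b) := by
    intro x hx
    obtain ⟨b, hb, hxb⟩ := hcov x hx
    refine Finset.mem_biUnion.2 ⟨b, hb, (hball _ _ _).2 ?_⟩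
    have := hxb (Metric.mem_closedBall_self (Nat.cast_nonneg _))
    simpa using this
  have hcard : (S.card : ℝ) ≤ ∑ b ∈ T, (5 : ℝ) ^ d * (box d (r b : ℝ)).card := by
    have h1 : S.card ≤ ∑ b ∈ T, (ball b (5 * r b)).card :=
      (Finset.card_le_card hsub).trans Finset.card_biUnion_le
    have h2 : (S.card : ℝ) ≤ ∑ b ∈ T, ((ball b (5 * r b)).card : ℝ) := by exact_mod_cast h1
    refine h2.trans (Finset.sum_le_sum fun b _ => ?_)
    simp only [ball, Finset.card_map]
    exact_mod_cast card_box_mul_le d 5 (r b) (by norm_num)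
  have hdisj' : (T : Set (Vert d)).PairwiseDisjoint fun b => ball b (r b) := by
    intro b hb b' hb' hne
    have := hdisj hb hb' hne
    rw [Function.onFun, Finset.disjoint_left]
    intro z hz hz'
    exact Set.disjoint_left.1 this ((hball _ _ _).1 hz) ((hball _ _ _).1 hz')
  calc a * S.card ≤ a * ∑ b ∈ T, (5 : ℝ) ^ d * (box d (r b : ℝ)).card := by gcongr
    _ = 5 ^ d * ∑ b ∈ T, a * (box d (r b : ℝ)).card := by
        rw [Finset.mul_sum, Finset.mul_sum]
        exact Finset.sum_congr rfl fun b _ => by ring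
    _ ≤ 5 ^ d * ∑ b ∈ T, ∑ y ∈ box d (r b : ℝ), u (y + b) := by
        gcongr with b hb
        exact (hr b (hTS' hb)).2
    _ = 5 ^ d * ∑ z ∈ T.biUnion fun b => ball b (r b), u z := by
        rw [Finset.sum_biUnion hdisj']
        simp [ball]
    _ ≤ 5 ^ d * ∑ z ∈ box d ((2 * N : ℕ) : ℝ), u z := by
        refine mul_le_mul_of_nonneg_left ?_ (by positivity)
        refine Finset.sum_le_sum_of_subset_of_nonneg (fun z hz => ?_) fun z _ _ => hu z
        obtain ⟨b, hb, hz⟩ := Finset.mem_biUnion.1 hz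
        simp only [ball, Finset.mem_map, addRightEmbedding_apply] at hz
        obtain ⟨y, hy, rfl⟩ := hz
        rw [two_mul]
        exact add_mem_box (box_subset_box (hr b (hTS' hb)).1 hy) (hS (hTS' hb))

theorem integral_comp_shift {d : ℕ} {P : Measure (EnvSp d)} (hP : ∀ x, P.map (shift d x) = P)
    (x : Vert d) {f : EnvSp d → ℝ} (hf : Measurable f) :
    ∫ ω, f (shift d x ω) ∂P = ∫ ω, f ω ∂P := by
  conv_rhs => rw [← hP x]
  rw [integral_map (measurable_shift d x).aemeasurable hf.aestronglyMeasurable]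

theorem IsBdd.comp_shift {d : ℕ} {f : EnvSp d → ℝ} (hf : IsBdd d f) (x : Vert d) :
    IsBdd d fun ω => f (shift d x ω) :=
  hf.imp fun _ h _ => h _

theorem measureReal_exists_le_blockAvg_le_aux {d : ℕ} {P : Measure (EnvSp d)}
    [IsProbabilityMeasure P] (hP : ∀ x, P.map (shift d x) = P) {f : EnvSp d → ℝ}
    (hf : Measurable f) (hb : IsBdd d f) (h0 : ∀ ω, 0 ≤ f ω) {a : ℝ} (ha : 0 < a) (N : ℕ) :
    P.real {ω | ∃ n ≤ N, a ≤ blockAvg d n f ω} ≤ 10 ^ d / a * ∫ ω, f ω ∂P := by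
  classical
  set E : Set (EnvSp d) := {ω | ∃ n ≤ N, a ≤ blockAvg d n f ω} with hE
  have hEm : MeasurableSet E := by
    have : E = ⋃ n ∈ Set.Iic N, {ω | a ≤ blockAvg d n f ω} := by ext; simp [hE]
    rw [this]
    exact .biUnion (Set.to_countable _) fun n _ =>
      measurableSet_le measurable_const (measurable_blockAvg hf)
  have hI : Measurable (E.indicator (1 : EnvSp d → ℝ)) := measurable_one.indicator hEm
  have hIb : IsBdd d (E.indicator (1 : EnvSp d → ℝ)) :=
    ⟨1, fun ω => by rw [Set.indicator_apply]; split_ifs <;> simp⟩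
  have hpt : ∀ ω, a * ∑ x ∈ box d (N : ℝ), E.indicator (1 : EnvSp d → ℝ) (shift d x ω) ≤
      5 ^ d * ∑ z ∈ box d ((2 * N : ℕ) : ℝ), f (shift d z ω) := by
    intro ω
    have := card_mul_le_of_forall_exists_box (u := fun z => f (shift d z ω)) (fun _ => h0 _) ha.le
      (Finset.filter_subset (fun x => shift d x ω ∈ E) (box d (N : ℝ))) (fun x hx => by
        obtain ⟨n, hn, h⟩ := (Finset.mem_filter.1 hx).2
        refine ⟨n, hn, ?_⟩
        rw [blockAvg, le_div_iff₀ (card_box_pos d n)] at h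
        simpa only [shift_shift] using h)
    rw [Finset.natCast_card_filter] at this
    simpa only [Set.indicator_apply, Pi.one_apply] using this
  have hIint : ∀ x, Integrable (fun ω => E.indicator (1 : EnvSp d → ℝ) (shift d x ω)) P :=
    fun x => (hIb.comp_shift x).integrable (hI.comp (measurable_shift d x)) P
  have hfint : ∀ x, Integrable (fun ω => f (shift d x ω)) P :=
    fun x => (hb.comp_shift x).integrable (hf.comp (measurable_shift d x)) P
  have hint := integral_mono (μ := P) ((integrable_finsetSum _ fun x _ => hIint x).const_mul a)
    ((integrable_finsetSum _ fun x _ => hfint x).const_mul (5 ^ d)) hpt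
  rw [integral_const_mul, integral_const_mul, integral_finsetSum, integral_finsetSum] at hint
  rotate_left
  · exact fun x _ => hfint x
  · exact fun x _ => hIint x
  simp only [integral_comp_shift hP _ hI, integral_comp_shift hP _ hf, Finset.sum_const,
    nsmul_eq_mul, integral_indicator_one hEm] at hint
  have hfi : 0 ≤ ∫ ω, f ω ∂P := integral_nonneg h0
  have hcard := card_box_mul_le d 2 N (by norm_num)
  have hpos := card_box_pos d N
  have h2 : (box d (N : ℝ)).card * (a * P.real E) ≤
      (box d (N : ℝ)).card * (10 ^ d * ∫ ω, f ω ∂P) := by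
    calc _ = a * ((box d (N : ℝ)).card * P.real E) := by ring
      _ ≤ 5 ^ d * ((box d ((2 * N : ℕ) : ℝ)).card * ∫ ω, f ω ∂P) := hint
      _ ≤ 5 ^ d * ((2 ^ d * (box d (N : ℝ)).card) * ∫ ω, f ω ∂P) := by gcongr; exact_mod_cast hcard
      _ = _ := by rw [show (10 : ℝ) = 5 * 2 by norm_num, mul_pow]; ring
  have h3 := le_of_mul_le_mul_left h2 hpos
  rw [div_mul_eq_mul_div, le_div_iff₀ ha]
  linarith

/-- The maximal inequality for spatial block averages. -/
theorem measureReal_exists_le_blockAvg_le {d : ℕ} {P : Measure (EnvSp d)}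
    [IsProbabilityMeasure P] (hP : ∀ x, P.map (shift d x) = P) {f : EnvSp d → ℝ}
    (hf : Measurable f) (hb : IsBdd d f) (h0 : ∀ ω, 0 ≤ f ω) {a : ℝ} (ha : 0 < a) :
    P.real {ω | ∃ n, a ≤ blockAvg d n f ω} ≤ 10 ^ d / a * ∫ ω, f ω ∂P := by
  have hU : {ω | ∃ n, a ≤ blockAvg d n f ω} = ⋃ N : ℕ, {ω | ∃ n ≤ N, a ≤ blockAvg d n f ω} := by
    ext ω
    simp only [Set.mem_iUnion, Set.mem_ofPred_eq]
    exact ⟨fun ⟨n, h⟩ => ⟨n, n, le_rfl, h⟩, fun ⟨_, n, _, h⟩ => ⟨n, h⟩⟩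
  have hmono : Monotone fun N : ℕ => {ω | ∃ n ≤ N, a ≤ blockAvg d n f ω} :=
    fun M N hMN ω ⟨n, hn, h⟩ => ⟨n, hn.trans hMN, h⟩
  have hlim := tendsto_measure_iUnion_atTop (μ := P) hmono
  rw [← hU] at hlim
  exact le_of_tendsto' ((ENNReal.tendsto_toReal (measure_ne_top P _)).comp hlim)
    fun N => measureReal_exists_le_blockAvg_le_aux hP hf hb h0 ha N

theorem ae_eq_const_of_shift_ae_eq {d : ℕ} {P : Measure (EnvSp d)} [IsProbabilityMeasure P]
    (hE : ErgodicEnv d P) {r : EnvSp d → ℝ} (hr : Measurable r)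
    (h : ∀ x, ∀ᵐ ω ∂P, r (shift d x ω) = r ω) : ∃ c, ∀ᵐ ω ∂P, r ω = c := by
  have hall : ∀ᵐ ω ∂P, ∀ x, r (shift d x ω) = r ω := ae_all_iff.2 h
  refine Filter.exists_eventuallyEq_const_of_forall_separating MeasurableSet fun U hU => ?_
  let B : Set (EnvSp d) := ⋂ x, shift d x ⁻¹' (r ⁻¹' U)
  have hB : MeasurableSet B := .iInter fun x => measurable_shift d x (hr hU)
  have hinv : ∀ y, shift d y ⁻¹' B = B := by
    intro y
    ext ω
    simp only [B, Set.mem_preimage, Set.mem_iInter, shift_shift]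
    exact ⟨fun h x => by simpa using h (x - y), fun h x => h _⟩
  have hmem : ∀ᵐ ω ∂P, ω ∈ B ↔ r ω ∈ U := hall.mono fun ω hω => by
    simp [B, hω]
  rcases hE B hB hinv with h0 | h1
  · right
    filter_upwards [hmem, measure_eq_zero_iff_ae_notMem.1 h0] with ω h1 h2
    exact fun h => h2 (h1.2 h)
  · left
    filter_upwards [hmem, (mem_ae_iff_prob_eq_one hB).2 h1] with ω h1 h2
    exact h1.1 h2

theorem IsBdd.memLp {d : ℕ} {f : EnvSp d → ℝ} (hf : IsBdd d f) (hm : Measurable f)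
    (P : Measure (EnvSp d)) [IsFiniteMeasure P] : MemLp f 2 P :=
  hf.elim fun M hM => MemLp.of_bound hm.aestronglyMeasurable M (.of_forall hM)

theorem IsBdd.add {d : ℕ} {f g : EnvSp d → ℝ} (hf : IsBdd d f) (hg : IsBdd d g) :
    IsBdd d fun ω => f ω + g ω := by
  obtain ⟨M, hM⟩ := hf
  obtain ⟨N, hN⟩ := hg
  exact ⟨M + N, fun ω => (abs_add_le _ _).trans (add_le_add (hM ω) (hN ω))⟩

theorem IsBdd.mul {d : ℕ} {f g : EnvSp d → ℝ} (hf : IsBdd d f) (hg : IsBdd d g) :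
    IsBdd d fun ω => f ω * g ω := by
  obtain ⟨M, hM⟩ := hf
  obtain ⟨N, hN⟩ := hg
  refine ⟨M * N, fun ω => ?_⟩
  rw [abs_mul]
  exact mul_le_mul (hM ω) (hN ω) (abs_nonneg _) ((abs_nonneg _).trans (hM ω))

theorem isBdd_const (d : ℕ) (c : ℝ) : IsBdd d fun _ => c := ⟨|c|, fun _ => le_rfl⟩

theorem IsBdd.sub {d : ℕ} {f g : EnvSp d → ℝ} (hf : IsBdd d f) (hg : IsBdd d g) :
    IsBdd d fun ω => f ω - g ω := by
  have := hf.add ((isBdd_const d (-1)).mul hg)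
  simpa [sub_eq_add_neg] using this

theorem isBdd_indicator_one {d : ℕ} (A : Set (EnvSp d)) :
    IsBdd d (A.indicator (1 : EnvSp d → ℝ)) := by
  classical
  exact ⟨1, fun ω => by rw [Set.indicator_apply]; split_ifs <;> simp⟩

/-- The classes in `L²` of bounded functions whose block averages tend to zero everywhere. -/
def nullAverages (d : ℕ) (P : Measure (EnvSp d)) : Submodule ℝ (Lp ℝ 2 P) where
  carrier := {v | ∃ h : EnvSp d → ℝ, Measurable h ∧ IsBdd d h ∧ (∀ ω, avgTo d ω h 0) ∧ v =ᵐ[P] h}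
  add_mem' := by
    rintro v w ⟨h, hm, hb, ha, hv⟩ ⟨k, km, kb, ka, hw⟩
    refine ⟨fun ω => h ω + k ω, hm.add km, hb.add kb, fun ω => ?_, ?_⟩
    · rw [avgTo_iff]
      simp only [blockAvg_add]
      simpa using (avgTo_iff.1 (ha ω)).add (avgTo_iff.1 (ka ω))
    · filter_upwards [Lp.coeFn_add v w, hv, hw] with ω h1 h2 h3
      rw [h1, Pi.add_apply, h2, h3]
  zero_mem' := by
    refine ⟨fun _ => 0, measurable_const, isBdd_const d 0, fun ω => ?_, Lp.coeFn_zero _ _ _⟩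
    rw [avgTo_iff]
    simp only [blockAvg_const]
    exact tendsto_const_nhds
  smul_mem' := by
    rintro c v ⟨h, hm, hb, ha, hv⟩
    refine ⟨fun ω => c * h ω, hm.const_mul c, (isBdd_const d c).mul hb, fun ω => ?_, ?_⟩
    · rw [avgTo_iff]
      simp only [blockAvg_const_mul]
      simpa using (avgTo_iff.1 (ha ω)).const_mul c
    · filter_upwards [Lp.coeFn_smul c v, hv] with ω h1 h2
      rw [h1, Pi.smul_apply, h2, smul_eq_mul]

theorem setIntegral_eq_of_mem_nullAverages_orthogonal {d : ℕ} {P : Measure (EnvSp d)}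
    [IsProbabilityMeasure P] {r : Lp ℝ 2 P} (hr : r ∈ (nullAverages d P)ᗮ) {A : Set (EnvSp d)}
    (hA : MeasurableSet A) (x : Vert d) :
    ∫ ω in shift d x ⁻¹' A, r ω ∂P = ∫ ω in A, r ω ∂P := by
  have hA' : MeasurableSet (shift d x ⁻¹' A) := measurable_shift d x hA
  have hri : Integrable r P := (Lp.memLp r).integrable one_le_two
  let h : EnvSp d → ℝ := fun ω =>
    (shift d x ⁻¹' A).indicator (1 : EnvSp d → ℝ) ω - A.indicator (1 : EnvSp d → ℝ) ω
  have hm : Measurable h := (measurable_one.indicator hA').sub (measurable_one.indicator hA)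
  have hb : IsBdd d h := (isBdd_indicator_one _).sub (isBdd_indicator_one _)
  have hv : (hb.memLp hm P).toLp h ∈ nullAverages d P := by
    refine ⟨h, hm, hb, fun ω => ?_, MemLp.coeFn_toLp _⟩
    rw [avgTo_iff]
    have := tendsto_blockAvg_shift_sub (isBdd_indicator_one A) x ω
    simp only [h, blockAvg_sub]
    simp only [blockAvg_shift] at this
    exact this
  have h0 := hr _ hv
  rw [L2.inner_def] at h0
  have h1 : ∫ ω, ((shift d x ⁻¹' A).indicator r ω - A.indicator r ω) ∂P = 0 := by
    refine (integral_congr_ae ?_).trans h0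
    filter_upwards [MemLp.coeFn_toLp (hb.memLp hm P)] with ω hω
    classical
    rw [hω]
    simp only [h, Set.indicator_apply, Pi.one_apply, RCLike.inner_apply, conj_trivial]
    split_ifs <;> simp
  rw [integral_sub (hri.indicator hA') (hri.indicator hA), integral_indicator hA',
    integral_indicator hA] at h1
  linarith

theorem ae_shift_eq_of_mem_nullAverages_orthogonal {d : ℕ} {P : Measure (EnvSp d)}
    [IsProbabilityMeasure P] (hP : ∀ x, P.map (shift d x) = P) {r : Lp ℝ 2 P}
    (hr : r ∈ (nullAverages d P)ᗮ) (x : Vert d) : ∀ᵐ ω ∂P, r (shift d x ω) = r ω := by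
  have hri : Integrable r P := (Lp.memLp r).integrable one_le_two
  have hpres : MeasurePreserving (shift d x) P P := ⟨measurable_shift d x, hP x⟩
  refine Integrable.ae_eq_of_forall_setIntegral_eq (fun ω => r (shift d x ω)) r
    (hpres.integrable_comp_of_integrable hri) hri fun A hA _ => ?_
  have hA' : MeasurableSet (shift d (-x) ⁻¹' A) := measurable_shift d (-x) hA
  rw [← setIntegral_eq_of_mem_nullAverages_orthogonal hr hA (-x)]
  have hmap := setIntegral_map hA' (Lp.stronglyMeasurable r).aestronglyMeasurable
    (measurable_shift d x).aemeasurable (μ := P)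
  have hpre : shift d x ⁻¹' (shift d (-x) ⁻¹' A) = A := by
    ext ω
    simp [shift_shift, shift_zero]
  rw [hP x, hpre] at hmap
  exact hmap.symm

theorem integral_abs_le_dist {d : ℕ} {P : Measure (EnvSp d)} [IsProbabilityMeasure P]
    (v w : Lp ℝ 2 P) : ∫ ω, |v ω - w ω| ∂P ≤ dist v w := by
  have hm : AEStronglyMeasurable (⇑v - ⇑w) P :=
    (Lp.aestronglyMeasurable v).sub (Lp.aestronglyMeasurable w)
  rw [Lp.dist_def]
  have h1 : ∫ ω, |v ω - w ω| ∂P = (eLpNorm (⇑v - ⇑w) 1 P).toReal := by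
    rw [eLpNorm_one_eq_lintegral_enorm, ← integral_norm_eq_lintegral_enorm hm]
    rfl
  rw [h1]
  exact ENNReal.toReal_mono (((Lp.memLp v).sub (Lp.memLp w)).2.ne)
    (eLpNorm_le_eLpNorm_of_exponent_le one_le_two hm)

theorem exists_null_average_near {d : ℕ} {P : Measure (EnvSp d)} [IsProbabilityMeasure P]
    (hP : ∀ x, P.map (shift d x) = P) (hE : ErgodicEnv d P) {f : EnvSp d → ℝ} (hf : Measurable f)
    (hb : IsBdd d f) (h0 : ∫ ω, f ω ∂P = 0) {δ : ℝ} (hδ : 0 < δ) :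
    ∃ h : EnvSp d → ℝ, Measurable h ∧ IsBdd d h ∧ (∀ ω, avgTo d ω h 0) ∧
      ∫ ω, |f ω - h ω| ∂P ≤ δ := by
  let F : Lp ℝ 2 P := (hb.memLp hf P).toLp
  have hF : F =ᵐ[P] f := MemLp.coeFn_toLp _
  have hmem : F ∈ (nullAverages d P)ᗮᗮ := by
    intro r hr
    obtain ⟨c, hc⟩ := ae_eq_const_of_shift_ae_eq hE (Lp.stronglyMeasurable r).measurable
      (ae_shift_eq_of_mem_nullAverages_orthogonal hP hr)
    rw [L2.inner_def]
    have : ∫ ω, inner ℝ (r ω) (F ω) ∂P = ∫ ω, c * f ω ∂P := by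
      refine integral_congr_ae ?_
      filter_upwards [hc, hF] with ω h1 h2
      rw [h1, h2]
      simp [mul_comm]
    rw [this, integral_const_mul, h0, mul_zero]
  rw [Submodule.orthogonal_orthogonal_eq_closure] at hmem
  obtain ⟨v, ⟨h, hm, hb', ha, hv⟩, hd⟩ := Metric.mem_closure_iff.1
    (show F ∈ closure (nullAverages d P : Set (Lp ℝ 2 P)) from hmem) δ hδ
  refine ⟨h, hm, hb', ha, ?_⟩
  have : ∫ ω, |f ω - h ω| ∂P = ∫ ω, |F ω - v ω| ∂P := by
    refine integral_congr_ae ?_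
    filter_upwards [hF, hv] with ω h1 h2
    rw [h1, h2]
  rw [this]
  exact (integral_abs_le_dist F v).trans hd.le

theorem ae_eventually_abs_blockAvg_lt {d : ℕ} {P : Measure (EnvSp d)} [IsProbabilityMeasure P]
    (hP : ∀ x, P.map (shift d x) = P) (hE : ErgodicEnv d P) {f : EnvSp d → ℝ} (hf : Measurable f)
    (hb : IsBdd d f) (h0 : ∫ ω, f ω ∂P = 0) {a : ℝ} (ha : 0 < a) :
    ∀ᵐ ω ∂P, ∀ᶠ n : ℕ in atTop, |blockAvg d n f ω| < 2 * a := by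
  rw [ae_iff, ← measureReal_eq_zero_iff]
  refine le_antisymm (le_of_forall_pos_le_add fun δ hδ => ?_) measureReal_nonneg
  obtain ⟨h, hm, hb', hav, hle⟩ := exists_null_average_near hP hE hf hb h0
    (δ := δ * a / 10 ^ d) (by positivity)
  have hgm : Measurable fun ω => |f ω - h ω| := (hf.sub hm).norm
  have hgb : IsBdd d fun ω => |f ω - h ω| := (hb.sub hb').imp fun M hM ω => by
    rw [abs_abs]; exact hM ω
  have hsub : {ω | ¬ ∀ᶠ n : ℕ in atTop, |blockAvg d n f ω| < 2 * a} ⊆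
      {ω | ∃ n, a ≤ blockAvg d n (fun ω => |f ω - h ω|) ω} := by
    intro ω hω
    by_contra hcon
    simp only [Set.mem_ofPred_eq, not_exists, not_le] at hcon
    refine hω ?_
    filter_upwards [(Metric.tendsto_nhds.1 (avgTo_iff.1 (hav ω))) a ha] with n hn
    rw [Real.dist_eq, sub_zero] at hn
    have h1 := (abs_blockAvg_le (d := d) (n := n) (ω := ω)
      (fun ω => le_refl |f ω - h ω|)).trans_lt (hcon n)
    rw [blockAvg_sub] at h1
    rw [abs_lt] at *
    constructor <;> linarith [h1.1, h1.2, hn.1, hn.2]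
  calc _ ≤ P.real {ω | ∃ n, a ≤ blockAvg d n (fun ω => |f ω - h ω|) ω} := measureReal_mono hsub
    _ ≤ 10 ^ d / a * ∫ ω, |f ω - h ω| ∂P :=
        measureReal_exists_le_blockAvg_le hP hgm hgb (fun _ => abs_nonneg _) ha
    _ ≤ 10 ^ d / a * (δ * a / 10 ^ d) := by gcongr
    _ = 0 + δ := by field_simp; ring

/-- The pointwise ergodic theorem for bounded functions. -/
theorem ae_avgTo {d : ℕ} {P : Measure (EnvSp d)} [IsProbabilityMeasure P]
    (hP : ∀ x, P.map (shift d x) = P) (hE : ErgodicEnv d P) {f : EnvSp d → ℝ} (hf : Measurable f)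
    (hb : IsBdd d f) : ∀ᵐ ω ∂P, avgTo d ω f (∫ ω', f ω' ∂P) := by
  set c := ∫ ω', f ω' ∂P with hc
  have h0 : ∫ ω, (f ω - c) ∂P = 0 := by
    rw [integral_sub (hb.integrable hf P) (integrable_const c)]
    simp [hc]
  have key : ∀ᵐ ω ∂P, ∀ m : ℕ, ∀ᶠ n : ℕ in atTop,
      |blockAvg d n (fun ω => f ω - c) ω| < 2 * (1 / ((m : ℝ) + 1)) :=
    ae_all_iff.2 fun m => ae_eventually_abs_blockAvg_lt hP hE (hf.sub_const c)
      (hb.sub (isBdd_const d c)) h0 (by positivity)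
  filter_upwards [key] with ω hω
  rw [avgTo_iff, Metric.tendsto_nhds]
  intro ε hε
  obtain ⟨m, hm⟩ := exists_nat_one_div_lt (half_pos hε)
  filter_upwards [hω m] with n hn
  rw [blockAvg_sub, blockAvg_const] at hn
  rw [Real.dist_eq]
  linarith

theorem IsEnvLaw.map_shift {d : ℕ} {ω : EnvSp d} {P : Measure (EnvSp d)} (hP : IsEnvLaw d ω P)
    (x : Vert d) : P.map (shift d x) = P := by
  have := hP.1
  have := Measure.isProbabilityMeasure_map (μ := P) (measurable_shift d x).aemeasurable
  refine ext_of_forall_integral_eq_of_IsFiniteMeasure fun f => ?_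
  have hb : IsBdd d f := ⟨‖f‖, f.norm_coe_le_norm⟩
  have h1 := hP.2 _ (f.continuous.comp (continuous_shift d x)) (hb.comp_shift x)
  have h2 := (avgTo_shift_iff hb x ω _).2 (hP.2 f f.continuous hb)
  rw [avgTo_iff] at h1 h2
  simp only [blockAvg_shift] at h2
  rw [integral_map (measurable_shift d x).aemeasurable f.continuous.aestronglyMeasurable]
  exact tendsto_nhds_unique h1 h2

theorem isEnvLaw_shift_iff {d : ℕ} {ω : EnvSp d} {P : Measure (EnvSp d)} (x : Vert d) :
    IsEnvLaw d (shift d x ω) P ↔ IsEnvLaw d ω P :=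
  and_congr_right fun _ => forall_congr' fun _ => forall_congr' fun _ => forall_congr' fun hb =>
    avgTo_shift_iff hb x ω _

theorem setIntegral_blockAvg {d : ℕ} {P : Measure (EnvSp d)} [IsProbabilityMeasure P]
    (hP : ∀ x, P.map (shift d x) = P) {f : EnvSp d → ℝ} (hf : Measurable f) (hb : IsBdd d f)
    {A : Set (EnvSp d)} (hA : MeasurableSet A) (hinv : ∀ x, shift d x ⁻¹' A = A) (k : ℕ) :
    ∫ ω in A, blockAvg d k f ω ∂P = ∫ ω in A, f ω ∂P := by
  have h : ∀ x, ∫ ω in A, f (shift d x ω) ∂P = ∫ ω in A, f ω ∂P := by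
    intro x
    have := setIntegral_map hA hf.aestronglyMeasurable (measurable_shift d x).aemeasurable (μ := P)
    rw [hP x, hinv x] at this
    exact this.symm
  simp only [blockAvg]
  rw [integral_div, integral_finsetSum _ fun x _ =>
    (hb.comp_shift x).integrable (hf.comp (measurable_shift d x)) _]
  simp only [h, Finset.sum_const, nsmul_eq_mul]
  exact mul_div_cancel_left₀ _ (card_box_pos d k).ne'

theorem tendsto_integral_blockAvg_sq {d : ℕ} {P : Measure (EnvSp d)} [IsProbabilityMeasure P]
    (hP : ∀ x, P.map (shift d x) = P) (hE : ErgodicEnv d P) {f : EnvSp d → ℝ} (hf : Measurable f)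
    (hb : IsBdd d f) :
    Tendsto (fun k => ∫ ω, blockAvg d k f ω ^ 2 ∂P) atTop (𝓝 ((∫ ω, f ω ∂P) ^ 2)) := by
  obtain ⟨M, hM⟩ := hb
  have hlim : (∫ ω, f ω ∂P) ^ 2 = ∫ _, (∫ ω, f ω ∂P) ^ 2 ∂P := by simp
  rw [hlim]
  refine tendsto_integral_of_dominated_convergence (fun _ => M ^ 2)
    (fun k => ((measurable_blockAvg hf).pow_const 2).aestronglyMeasurable) (integrable_const _)
    (fun k => .of_forall fun ω => ?_) ?_
  · rw [Real.norm_eq_abs, abs_pow]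
    have := (abs_blockAvg_le (n := k) (ω := ω) hM).trans_eq (blockAvg_const M)
    gcongr
  · filter_upwards [ae_avgTo hP hE hf ⟨M, hM⟩] with ω hω
    exact (avgTo_iff.1 hω).pow 2

theorem setIntegral_eq_of_tendsto_integral_sq {d : ℕ} {P : Measure (EnvSp d)}
    [IsProbabilityMeasure P] (hP : ∀ x, P.map (shift d x) = P) {f : EnvSp d → ℝ}
    (hf : Measurable f) (hb : IsBdd d f)
    (h : Tendsto (fun k => ∫ ω, blockAvg d k f ω ^ 2 ∂P) atTop (𝓝 ((∫ ω, f ω ∂P) ^ 2)))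
    {A : Set (EnvSp d)} (hA : MeasurableSet A) (hinv : ∀ x, shift d x ⁻¹' A = A) :
    ∫ ω in A, f ω ∂P = P.real A * ∫ ω, f ω ∂P := by
  set c := ∫ ω, f ω ∂P with hc
  have hbk : ∀ k, IsBdd d (blockAvg d k f) := hb.blockAvg
  have hmk : ∀ k, Measurable (blockAvg d k f) := fun k => measurable_blockAvg hf
  have hik : ∀ k, Integrable (blockAvg d k f) P := fun k => (hbk k).integrable (hmk k) P
  have hsq : ∀ k, Integrable (fun ω => blockAvg d k f ω ^ 2) P := fun k => by
    have := ((hbk k).mul (hbk k)).integrable ((hmk k).mul (hmk k)) P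
    simpa only [sq] using this
  have hmean : ∀ k, ∫ ω, blockAvg d k f ω ∂P = c := fun k => by
    have := setIntegral_blockAvg hP hf hb .univ (fun _ => rfl) k
    simpa using this
  have hvar : ∀ k, ∫ ω, (blockAvg d k f ω - c) ^ 2 ∂P = ∫ ω, blockAvg d k f ω ^ 2 ∂P - c ^ 2 := by
    intro k
    have h1 : ∀ ω, (blockAvg d k f ω - c) ^ 2 =
        blockAvg d k f ω ^ 2 - 2 * c * blockAvg d k f ω + c ^ 2 := fun ω => by ring
    have h2 : Integrable (fun ω => blockAvg d k f ω ^ 2 - 2 * c * blockAvg d k f ω) P :=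
      (hsq k).sub ((hik k).const_mul _)
    simp only [h1]
    rw [integral_add h2 (integrable_const _),
      integral_sub (hsq k) ((hik k).const_mul _), integral_const_mul, hmean]
    simp
    ring
  have hvi : ∀ k, Integrable (fun ω => (blockAvg d k f ω - c) ^ 2) P := fun k => by
    have hb' := (hbk k).sub (isBdd_const d c)
    have hm' := (hmk k).sub_const c
    have := (hb'.mul hb').integrable (hm'.mul hm') P
    simpa only [sq] using this
  have hbound : ∀ t > 0, |∫ ω in A, f ω ∂P - P.real A * c| ≤ t := by
    intro t ht
    have hlim : Tendsto (fun k => t + (∫ ω, blockAvg d k f ω ^ 2 ∂P - c ^ 2) / t) atTop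
        (𝓝 (t + (c ^ 2 - c ^ 2) / t)) := ((h.sub_const _).div_const t).const_add t
    rw [sub_self, zero_div, add_zero] at hlim
    refine ge_of_tendsto' hlim fun k => ?_
    have h1 : ∫ ω in A, f ω ∂P - P.real A * c = ∫ ω in A, (blockAvg d k f ω - c) ∂P := by
      rw [integral_sub (hik k).integrableOn (integrable_const _).integrableOn,
        setIntegral_blockAvg hP hf hb hA hinv]
      simp
    rw [h1]
    have hi : Integrable (fun ω => |blockAvg d k f ω - c|) P :=
      ((hik k).sub (integrable_const c)).abs
    calc |∫ ω in A, (blockAvg d k f ω - c) ∂P| ≤ ∫ ω in A, |blockAvg d k f ω - c| ∂P :=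
          abs_integral_le_integral_abs
      _ ≤ ∫ ω, |blockAvg d k f ω - c| ∂P :=
          setIntegral_le_integral hi (.of_forall fun _ => abs_nonneg _)
      _ ≤ ∫ ω, (t + (blockAvg d k f ω - c) ^ 2 / t) ∂P := by
          refine integral_mono hi ((integrable_const t).add ((hvi k).div_const t)) fun ω => ?_
          dsimp only
          rw [← sq_abs (blockAvg d k f ω - c)]
          set y := |blockAvg d k f ω - c|
          have : 0 ≤ y := abs_nonneg _
          rw [← sub_le_iff_le_add', le_div_iff₀ ht]
          nlinarith [sq_nonneg (y - t)]
      _ = _ := by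
          rw [integral_add (integrable_const t) ((hvi k).div_const t), integral_div, hvar]
          simp
  have := le_of_forall_pos_le_add fun t ht => (hbound t ht).trans_eq (zero_add t).symm
  exact sub_eq_zero.1 (abs_nonpos_iff.1 this)

theorem ergodicEnv_of_tendsto {d : ℕ} {P : Measure (EnvSp d)} [IsProbabilityMeasure P]
    (hP : ∀ x, P.map (shift d x) = P)
    (h : ∀ j, Tendsto (fun k => ∫ ω, blockAvg d k (testFn d (denseFn d j)) ω ^ 2 ∂P) atTop
      (𝓝 ((∫ ω, testFn d (denseFn d j) ω ∂P) ^ 2))) : ErgodicEnv d P := by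
  intro A hA hinv
  have hemb := measurableEmbedding_compactEmb d
  have hint : ∀ g, Integrable (testFn d g) P := fun g =>
    (isBdd_testFn g).integrable (continuous_testFn g).measurable P
  have key : ∀ g, ∫ ω in A, testFn d g ω ∂P = P.real A * ∫ ω, testFn d g ω ∂P := by
    intro g
    have hbound : ∀ t > 0,
        |∫ ω in A, testFn d g ω ∂P - P.real A * ∫ ω, testFn d g ω ∂P| ≤ 0 + t := by
      intro t ht
      obtain ⟨j, hj⟩ := exists_denseFn_near g (half_pos ht)
      have hD := setIntegral_eq_of_tendsto_integral_sq hP (continuous_testFn (denseFn d j)).measurable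
        (isBdd_testFn _) (h j) hA hinv
      have e1 : |∫ ω in A, testFn d g ω ∂P - ∫ ω in A, testFn d (denseFn d j) ω ∂P| ≤ t / 2 := by
        rw [← integral_sub (hint g).integrableOn (hint _).integrableOn]
        refine (norm_integral_le_of_norm_le_const
          (f := fun ω => testFn d g ω - testFn d (denseFn d j) ω) (.of_forall fun ω =>
          (abs_testFn_sub_le g (denseFn d j) ω).trans hj)).trans ?_
        refine mul_le_of_le_one_right (by positivity) ?_
        rw [measureReal_restrict_apply .univ]
        exact measureReal_le_one
      have e2 : |∫ ω, testFn d g ω ∂P - ∫ ω, testFn d (denseFn d j) ω ∂P| ≤ t / 2 := by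
        rw [← integral_sub (hint g) (hint _)]
        refine (norm_integral_le_of_norm_le_const
          (f := fun ω => testFn d g ω - testFn d (denseFn d j) ω) (.of_forall fun ω =>
          (abs_testFn_sub_le g (denseFn d j) ω).trans hj)).trans ?_
        exact mul_le_of_le_one_right (by positivity) measureReal_le_one
      have e3 : |P.real A * (∫ ω, testFn d g ω ∂P - ∫ ω, testFn d (denseFn d j) ω ∂P)| ≤ t / 2 := by
        rw [abs_mul, abs_of_nonneg measureReal_nonneg]
        exact (mul_le_of_le_one_left (abs_nonneg _) measureReal_le_one).trans e2
      rw [hD] at e1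
      rw [mul_sub] at e3
      rw [abs_le] at *
      constructor <;> linarith [e1.1, e1.2, e3.1, e3.2]
    exact sub_eq_zero.1 (abs_nonpos_iff.1 (le_of_forall_pos_le_add hbound))
  have hmeas : (P.restrict A).map (compactEmb d) = (P A • P).map (compactEmb d) := by
    have : IsFiniteMeasure (P A • P) := Measure.smul_finite P (measure_ne_top P A)
    refine ext_of_forall_integral_eq_of_IsFiniteMeasure fun f => ?_
    rw [hemb.integral_map, hemb.integral_map, integral_smul_measure]
    exact key f.toContinuousMap
  have hA2 : P A = P A * P A := by
    have := congrArg (fun μ => μ (compactEmb d '' A)) hmeas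
    simpa only [hemb.map_apply, Set.preimage_image_eq _ hemb.injective, Measure.restrict_apply_self,
      Measure.smul_apply, smul_eq_mul] using this
  by_cases h0 : P A = 0
  · exact .inl h0
  · exact .inr ((ENNReal.mul_eq_left h0 (measure_ne_top P A)).1 hA2.symm)

theorem IsEnvLaw.ergodicEnv_iff {d : ℕ} {ω : EnvSp d} {P : Measure (EnvSp d)}
    (hP : IsEnvLaw d ω P) :
    ErgodicEnv d P ↔ ∀ j, Tendsto (fun k => limsup (fun n =>
        blockAvg d n (fun ω' => blockAvg d k (testFn d (denseFn d j)) ω' ^ 2) ω) atTop) atTop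
      (𝓝 (limsup (fun n => blockAvg d n (testFn d (denseFn d j)) ω) atTop ^ 2)) := by
  have := hP.1
  have h1 : ∀ j, limsup (fun n => blockAvg d n (testFn d (denseFn d j)) ω) atTop =
      ∫ ω', testFn d (denseFn d j) ω' ∂P := fun j =>
    (avgTo_iff.1 (hP.2 _ (continuous_testFn _) (isBdd_testFn _))).limsup_eq
  have h2 : ∀ j k, limsup (fun n =>
      blockAvg d n (fun ω' => blockAvg d k (testFn d (denseFn d j)) ω' ^ 2) ω) atTop =
      ∫ ω', blockAvg d k (testFn d (denseFn d j)) ω' ^ 2 ∂P := fun j k =>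
    (avgTo_iff.1 (hP.2 _ ((continuous_blockAvg (continuous_testFn _)).pow 2) (by
      have hb := (isBdd_testFn (denseFn d j)).blockAvg k
      exact (hb.mul hb).imp fun M hM ω => by simpa only [Pi.pow_apply, sq] using hM ω))).limsup_eq
  simp only [h1, h2]
  exact ⟨fun hE j => tendsto_integral_blockAvg_sq hP.map_shift hE (continuous_testFn _).measurable
    (isBdd_testFn _), ergodicEnv_of_tendsto hP.map_shift⟩

/-- A description of `Ω⋆` by countably many limits of measurable functions. -/
theorem inOmegaStar_iff {d : ℕ} {ω : EnvSp d} :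
    InOmegaStar d ω ↔ Tempered d ω ∧
      (∀ j, ∃ L, Tendsto (fun n => blockAvg d n (testFn d (denseFn d j)) ω) atTop (𝓝 L)) ∧
      ∀ j, Tendsto (fun k => limsup (fun n =>
        blockAvg d n (fun ω' => blockAvg d k (testFn d (denseFn d j)) ω' ^ 2) ω) atTop) atTop
      (𝓝 (limsup (fun n => blockAvg d n (testFn d (denseFn d j)) ω) atTop ^ 2)) := by
  constructor
  · rintro ⟨hT, hA, hE⟩
    have h := hT.exists_avgTo_testFn hA
    obtain ⟨P, hP⟩ := hT.exists_isEnvLaw h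
    exact ⟨hT, fun j => h _, hP.ergodicEnv_iff.1 (hE P hP)⟩
  · rintro ⟨hT, hA, hE⟩
    obtain ⟨P, hP⟩ := hT.exists_isEnvLaw (exists_avgTo_testFn_of_denseFn hA)
    exact ⟨hT, hP.averaging, fun Q hQ => hQ.ergodicEnv_iff.2 hE⟩

theorem measurableSet_inOmegaStar (d : ℕ) : MeasurableSet {ω : EnvSp d | InOmegaStar d ω} := by
  simp only [inOmegaStar_iff]
  have hm : ∀ j n, Measurable (blockAvg d n (testFn d (denseFn d j))) := fun j n =>
    measurable_blockAvg (continuous_testFn _).measurable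
  refine (measurableSet_tempered d).inter (.inter ?_ ?_)
  · refine measurableSet_setOfPred.2 (.forall fun j => ?_)
    exact measurableSet_setOfPred.1 (measurableSet_exists_tendsto (hm j))
  · refine measurableSet_setOfPred.2 (.forall fun j => measurableSet_setOfPred.1 ?_)
    exact measurableSet_tendsto_fun
      (fun k => .limsup fun n => measurable_blockAvg ((hm j k).pow_const 2))
      ((Measurable.limsup (hm j)).pow_const 2)

theorem InOmegaStar.shift {d : ℕ} {ω : EnvSp d} (h : InOmegaStar d ω) (x : Vert d) :
    InOmegaStar d (shift d x ω) := by
  refine ⟨h.1.shift x, fun f hf hl => ?_, fun P hP => h.2.2 P ((isEnvLaw_shift_iff x).1 hP)⟩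
  obtain ⟨L, hL⟩ := h.2.1 f hf hl
  exact ⟨L, (avgTo_shift_iff (isBdd_of_isLocalFn hf hl) x ω L).2 hL⟩

theorem tendsto_integral_badCount (d : ℕ) (P : Measure (EnvSp d)) [IsProbabilityMeasure P] :
    Tendsto (fun m : ℕ => ∫ ω, badCount d (1 / ((m : ℝ) + 1)) ω ∂P) atTop (𝓝 0) := by
  have hz : ∫ _ : EnvSp d, (0 : ℝ) ∂P = 0 := integral_zero _ _
  suffices h : Tendsto (fun m : ℕ => ∫ ω, badCount d (1 / ((m : ℝ) + 1)) ω ∂P) atTop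
      (𝓝 (∫ _ : EnvSp d, (0 : ℝ) ∂P)) by rwa [hz] at h
  refine tendsto_integral_of_dominated_convergence (fun _ => d)
    (fun m => measurable_badCount.aestronglyMeasurable) (integrable_const _)
    (fun m => .of_forall fun ω => ?_) (.of_forall fun ω => ?_)
  · rw [Real.norm_eq_abs, abs_of_nonneg badCount_nonneg, badCount]
    refine (Finset.sum_le_sum fun i _ => badAt_le_one).trans ?_
    simp
  · refine tendsto_const_nhds.congr' ?_
    have hlim := tendsto_one_div_add_atTop_nhds_zero_nat (𝕜 := ℝ)
    have hpos : ∀ i : Fin d, ∀ᶠ m : ℕ in atTop, badAt d (1 / ((m : ℝ) + 1)) (0, i) ω = 0 := by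
      intro i
      filter_upwards [hlim.eventually_le_const (ω.2 (0, i)),
        hlim.eventually_le_const (inv_pos.2 (ω.2 (0, i)))] with m h1 h2
      refine if_pos ⟨h1, ?_⟩
      rwa [le_inv_comm₀ (ω.2 _) (by positivity)]
    filter_upwards [eventually_all.2 hpos] with m hm
    exact (Finset.sum_eq_zero fun i _ => hm i).symm

theorem ae_tempered {d : ℕ} {P : Measure (EnvSp d)} [IsProbabilityMeasure P]
    (hP : ∀ x, P.map (shift d x) = P) (hE : ErgodicEnv d P) : ∀ᵐ ω ∂P, Tempered d ω := by
  have h : ∀ᵐ ω ∂P, ∀ m : ℕ, avgTo d ω (badCount d (1 / ((m : ℝ) + 1)))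
      (∫ ω', badCount d (1 / ((m : ℝ) + 1)) ω' ∂P) :=
    ae_all_iff.2 fun m => ae_avgTo hP hE measurable_badCount isBdd_badCount
  filter_upwards [h] with ω hω
  refine tempered_iff.2 fun δ hδ => ?_
  obtain ⟨m, hm⟩ := ((tendsto_integral_badCount d P).eventually_lt_const hδ).exists
  exact ⟨1 / ((m : ℝ) + 1), by positivity,
    ((avgTo_iff.1 (hω m)).eventually_lt_const hm).mono fun n hn => hn.le⟩

theorem ae_inOmegaStar {d : ℕ} {P : Measure (EnvSp d)} [IsProbabilityMeasure P]
    (hP : ∀ x, P.map (shift d x) = P) (hE : ErgodicEnv d P) : ∀ᵐ ω ∂P, InOmegaStar d ω := by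
  have h : ∀ᵐ ω ∂P, ∀ j, avgTo d ω (testFn d (denseFn d j)) (∫ ω', testFn d (denseFn d j) ω' ∂P) :=
    ae_all_iff.2 fun j => ae_avgTo hP hE (continuous_testFn _).measurable (isBdd_testFn _)
  filter_upwards [h, ae_tempered hP hE] with ω hω hT
  have hlaw := isEnvLaw_of_denseFn hω
  exact ⟨hT, hlaw.averaging, fun Q hQ => hlaw.unique hQ ▸ hE⟩

/-- Proposition 3.1: `Ω⋆` is measurable, translation invariant and of
full measure for every translation-invariant ergodic probability measure. -/
theorem statement2 (d : ℕ) (hd : 1 ≤ d) :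
    MeasurableSet {ω : EnvSp d | InOmegaStar d ω} ∧
    (∀ ω : EnvSp d, InOmegaStar d ω ↔ ∀ x : Vert d, InOmegaStar d (shift d x ω)) ∧
    (∀ ν : Measure (EnvSp d), IsProbabilityMeasure ν →
        (∀ x : Vert d, ν.map (shift d x) = ν) → ErgodicEnv d ν →
        ν {ω : EnvSp d | InOmegaStar d ω} = 1) := by
  refine ⟨measurableSet_inOmegaStar d, fun ω => ⟨fun h => h.shift, fun h => ?_⟩,
    fun ν _ hν hE => ?_⟩
  · simpa only [shift_zero] using h 0
  · exact (mem_ae_iff_prob_eq_one (measurableSet_inOmegaStar d)).1 (ae_inOmegaStar hν hE)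


end DetCond
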